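/- If L is a low 1-random set and M is a ∅'-computable martingale, then there exists a set B ⊆ ℕ on which M does not succeed such that L ⊕ B is both low and 1-random. -/

import Mathlib

/-!
Preamble: oracle computability, Turing reducibility, the jump, martingales,
and Martin-Löf randomness, developed from scratch.
-/

open scoped Classical

/-- The characteristic function of a set of naturals. -/
noncomputable def chi (A : Set ℕ) : ℕ → ℕ :=
  fun n => if n ∈ A then 1 else 0

/-- Partial functions recursive in a (total) oracle `O : ℕ → ℕ`.
This mirrors `Nat.Partrec`, with an additional constructor for the oracle. -/
inductive RecIn (O : ℕ → ℕ) : (ℕ →. ℕ) → Prop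
  | oracle : RecIn O (fun n => Part.some (O n))
  | zero : RecIn O (fun _ => Part.some 0)
  | succ : RecIn O (fun n => Part.some (n + 1))
  | left : RecIn O (fun n => Part.some (Nat.unpair n).1)
  | right : RecIn O (fun n => Part.some (Nat.unpair n).2)
  | pair {f g} : RecIn O f → RecIn O g → RecIn O (fun n => Nat.pair <$> f n <*> g n)
  | comp {f g} : RecIn O f → RecIn O g → RecIn O (fun n => g n >>= f)
  | prec {f g} :
      RecIn O f → RecIn O g →
      RecIn O
        (Nat.unpaired fun a n =>
          n.rec (f a) fun y IH => do
            let i ← IH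
            g (Nat.pair a (Nat.pair y i)))
  | rfind {f} :
      RecIn O f →
      RecIn O (fun a => Nat.rfind fun n => (fun m => m = 0) <$> f (Nat.pair a n))

/-- Codes for oracle machines. -/
inductive OCode : Type
  | zero : OCode
  | succ : OCode
  | left : OCode
  | right : OCode
  | oracle : OCode
  | pair : OCode → OCode → OCode
  | comp : OCode → OCode → OCode
  | prec : OCode → OCode → OCode
  | rfind' : OCode → OCode

/-- Evaluation of oracle codes relative to a total oracle. -/
def evalo (O : ℕ → ℕ) : OCode → ℕ →. ℕ
  | .zero => fun _ => Part.some 0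
  | .succ => fun n => Part.some (n + 1)
  | .left => fun n => Part.some (Nat.unpair n).1
  | .right => fun n => Part.some (Nat.unpair n).2
  | .oracle => fun n => Part.some (O n)
  | .pair cf cg => fun n => Nat.pair <$> evalo O cf n <*> evalo O cg n
  | .comp cf cg => fun n => evalo O cg n >>= evalo O cf
  | .prec cf cg =>
      Nat.unpaired fun a n =>
        n.rec (evalo O cf a) fun y IH => do
          let i ← IH
          evalo O cg (Nat.pair a (Nat.pair y i))
  | .rfind' cf =>
      Nat.unpaired fun a m =>
        (Nat.rfind fun n => (fun x => x = 0) <$> evalo O cf (Nat.pair a (n + m))).map (· + m)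

/-- A surjective listing of oracle codes. -/
def ofNatOCode : ℕ → OCode
  | 0 => .zero
  | 1 => .succ
  | 2 => .left
  | 3 => .right
  | 4 => .oracle
  | n + 5 =>
    have hm : n.div2.div2 < n + 5 := by
      rw [Nat.div2_val, Nat.div2_val]
      exact lt_of_le_of_lt (le_trans (Nat.div_le_self _ _) (Nat.div_le_self _ _))
        (Nat.lt_succ_of_le (Nat.le_add_right _ 4))
    have _m1 : n.div2.div2.unpair.1 < n + 5 :=
      lt_of_le_of_lt (Nat.unpair_left_le _) hm
    have _m2 : n.div2.div2.unpair.2 < n + 5 :=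
      lt_of_le_of_lt (Nat.unpair_right_le _) hm
    match n.bodd, n.div2.bodd with
    | false, false => .pair (ofNatOCode n.div2.div2.unpair.1) (ofNatOCode n.div2.div2.unpair.2)
    | false, true  => .comp (ofNatOCode n.div2.div2.unpair.1) (ofNatOCode n.div2.div2.unpair.2)
    | true , false => .prec (ofNatOCode n.div2.div2.unpair.1) (ofNatOCode n.div2.div2.unpair.2)
    | true , true  => .rfind' (ofNatOCode n.div2.div2)

/-- `Phi O e` is the `e`-th partial `O`-computable function `Φ_e^O`. -/
def Phi (O : ℕ → ℕ) (e : ℕ) : ℕ →. ℕ := evalo O (ofNatOCode e)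

/-- The Turing jump `A'` of a set `A`. -/
noncomputable def jump (A : Set ℕ) : Set ℕ := {e | (Phi (chi A) e e).Dom}

/-- The halting set `∅'`. -/
noncomputable def K : Set ℕ := jump ∅

/-- Turing reducibility between sets: `TRed B A` means `B ≤_T A`. -/
noncomputable def TRed (B A : Set ℕ) : Prop :=
  RecIn (chi A) (fun n => Part.some (chi B n))

/-- The effective join of two sets. -/
def join (A B : Set ℕ) : Set ℕ :=
  {n | (∃ a ∈ A, n = 2 * a) ∨ (∃ b ∈ B, n = 2 * b + 1)}

/-- A set is low if its jump is Turing reducible to `∅'`. -/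
noncomputable def Low (L : Set ℕ) : Prop := TRed (jump L) K

/-- The function `f : α → β` presented as an oracle on `ℕ`, via the encodings. -/
def fnOracle {α β : Type} [Encodable α] [Encodable β] (f : α → β) : ℕ → ℕ :=
  fun n => Encodable.encode ((Encodable.decode (α := α) n).map f)

/-- `FRed f A` means the function `f` is Turing reducible to the set `A`. -/
noncomputable def FRed {α β : Type} [Encodable α] [Encodable β] (f : α → β) (A : Set ℕ) : Prop :=
  RecIn (chi A) (fun n => Part.some (fnOracle f n))

/-- `FFRed g f` means the function `g` is Turing reducible to the function `f`. -/
def FFRed {α β γ δ : Type} [Encodable α] [Encodable β] [Encodable γ] [Encodable δ]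
    (g : γ → δ) (f : α → β) : Prop :=
  RecIn (fnOracle f) (fun n => Part.some (fnOracle g n))

/-- A martingale: a nonnegative rational-valued function on finite binary strings
satisfying the averaging condition `2 M(σ) = M(σ0) + M(σ1)`. -/
def IsMartingale (M : List Bool → ℚ) : Prop :=
  (∀ σ, 0 ≤ M σ) ∧ ∀ σ, 2 * M σ = M (σ ++ [false]) + M (σ ++ [true])

/-- The length-`n` initial segment of the characteristic sequence of `A`. -/
noncomputable def seg (A : Set ℕ) (n : ℕ) : List Bool :=
  (List.range n).map fun i => if i ∈ A then true else false

/-- A martingale succeeds on a set `A` if `limsup_n M(A↾n) = ∞`. -/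
noncomputable def Succeeds (M : List Bool → ℚ) (A : Set ℕ) : Prop :=
  ∀ q : ℚ, ∃ n, q < M (seg A n)

/-- `H(A)`: the mass problem of infinite subsets or cosubsets of `A`. -/
def Hset (A : Set ℕ) : Set (Set ℕ) :=
  {S | S.Infinite ∧ (S ⊆ A ∨ S ⊆ Aᶜ)}

/-- Muchnik reducibility: `MuchnikLe P Q` iff every member of `Q` computes a member of `P`. -/
noncomputable def MuchnikLe (P Q : Set (Set ℕ)) : Prop :=
  ∀ B ∈ Q, ∃ A ∈ P, TRed A B

/-- A set of naturals is computably enumerable. -/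
def CE (W : Set ℕ) : Prop :=
  ∃ g : ℕ →. ℕ, RecIn (fun _ => 0) g ∧ ∀ n, n ∈ W ↔ (g n).Dom

/-- A Martin-Löf test: a uniformly c.e. sequence of sets of strings `U n`,
with the open set generated by `U n` having measure at most `2^{-n}`. -/
def MLTest (U : ℕ → Set (List Bool)) : Prop :=
  CE {p : ℕ | ∃ σ ∈ U (Nat.unpair p).1, (Nat.unpair p).2 = Encodable.encode σ} ∧
  ∀ n, (∑' σ : (U n), ((1 : ENNReal) / 2) ^ (σ : List Bool).length) ≤ (1 / 2) ^ n

/-- A set is 1-random (Martin-Löf random) if for every Martin-Löf test there is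
an `n` such that no initial segment of the set lies in `U n`. -/
noncomputable def MLRandom (A : Set ℕ) : Prop :=
  ∀ U : ℕ → Set (List Bool), MLTest U → ∃ n, ∀ m, seg A m ∉ U n

section Part1

/-! ### Basic relative computability -/

theorem RecIn.of_eq {O : ℕ → ℕ} {f g : ℕ →. ℕ} (h : RecIn O f) (e : ∀ n, f n = g n) : RecIn O g := by
  have : f = g := funext e
  exact this ▸ h

theorem RecIn.of_partrec {O : ℕ → ℕ} {f : ℕ →. ℕ} (h : Nat.Partrec f) : RecIn O f := by
  induction h with
  | zero => exact RecIn.zero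
  | succ => exact RecIn.succ
  | left => exact RecIn.left
  | right => exact RecIn.right
  | pair _ _ h1 h2 => exact RecIn.pair h1 h2
  | comp _ _ h1 h2 => exact RecIn.comp h1 h2
  | prec _ _ h1 h2 => exact RecIn.prec h1 h2
  | rfind _ h1 => exact RecIn.rfind h1

theorem RecIn.to_partrec {f : ℕ →. ℕ} (h : RecIn (fun _ => 0) f) : Nat.Partrec f := by
  induction h with
  | oracle => exact Nat.Partrec.zero
  | zero => exact Nat.Partrec.zero
  | succ => exact Nat.Partrec.succ
  | left => exact Nat.Partrec.left
  | right => exact Nat.Partrec.right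
  | pair _ _ h1 h2 => exact Nat.Partrec.pair h1 h2
  | comp _ _ h1 h2 => exact Nat.Partrec.comp h1 h2
  | prec _ _ h1 h2 => exact Nat.Partrec.prec h1 h2
  | rfind _ h1 => exact Nat.Partrec.rfind h1

/-- total functions recursive in the oracle -/
def TR (O : ℕ → ℕ) (f : ℕ → ℕ) : Prop := RecIn O (fun n => Part.some (f n))

theorem TR.of_eq {O f g} (h : TR O f) (e : ∀ n, f n = g n) : TR O g := by
  have : f = g := funext e
  exact this ▸ h

theorem TR.of_computable {O} {f : ℕ → ℕ} (h : Computable f) : TR O f :=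
  RecIn.of_partrec (Partrec.nat_iff.1 h)

theorem TR.comp {O f g} (hf : TR O f) (hg : TR O g) : TR O (fun n => f (g n)) :=
  RecIn.of_eq (RecIn.comp hf hg) (fun n => by simp)

theorem TR.pair {O f g} (hf : TR O f) (hg : TR O g) : TR O (fun n => Nat.pair (f n) (g n)) :=
  RecIn.of_eq (RecIn.pair hf hg) (fun n => by simp [Seq.seq])

theorem TR.prec {O f g} (hf : TR O f) (hg : TR O g) :
    TR O (fun p => Nat.rec (f p.unpair.1)
      (fun y i => g (Nat.pair p.unpair.1 (Nat.pair y i))) p.unpair.2) := by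
  refine RecIn.of_eq (RecIn.prec hf hg) (fun p => ?_)
  simp only [Nat.unpaired]
  generalize p.unpair.1 = a
  induction p.unpair.2 with
  | zero => rfl
  | succ n ih => simp only [ih]; simp

theorem TR.rfind {O} {f h : ℕ → ℕ} (hf : TR O f)
    (hh : ∀ a, f (Nat.pair a (h a)) = 0 ∧ ∀ m < h a, f (Nat.pair a m) ≠ 0) : TR O h := by
  refine RecIn.of_eq (RecIn.rfind hf) (fun a => ?_)
  refine Part.eq_some_iff.2 ?_
  refine Nat.mem_rfind.2 ⟨?_, ?_⟩
  · simp [(hh a).1]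
  · intro m hm
    simp [(hh a).2 m hm]

section CIn
variable {α β γ δ : Type}

/-- `f` is computable in the oracle. -/
def CIn [Encodable α] [Encodable β] (O : ℕ → ℕ) (f : α → β) : Prop :=
  TR O (fnOracle f)

theorem fnOracle_encode [Encodable α] [Encodable β] (f : α → β) (a : α) :
    fnOracle f (Encodable.encode a) = Encodable.encode (f a) + 1 := by
  simp [fnOracle]

theorem CIn.of_eq [Encodable α] [Encodable β] {O} {f g : α → β} (h : CIn O f)
    (e : ∀ n, f n = g n) : CIn O g := by
  have : f = g := funext e
  exact this ▸ h

theorem CIn.of_computable [Primcodable α] [Primcodable β] {O} {f : α → β} (h : Computable f) :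
    CIn O f := by
  apply TR.of_computable
  have : Computable fun n : ℕ => (Encodable.decode (α := α) n).map f :=
    Computable.option_map Computable.decode (h.comp Computable.snd)
  exact Computable.encode.comp this

theorem CIn.of_primrec [Primcodable α] [Primcodable β] {O} {f : α → β} (h : Primrec f) :
    CIn O f := CIn.of_computable h.to_comp

/-- raw lift of a function past an option code -/
theorem TR.optlift {O g} (hg : TR O g) : TR O (fun n => Nat.casesOn n 0 (fun m => g m)) := by
  have h0 : TR O (fun _ => 0) := RecIn.zero
  have h1 : TR O (fun n => g n.unpair.2.unpair.1) :=
    hg.comp (TR.of_computable (Computable.fst.comp (Computable.unpair.comp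
      (Computable.snd.comp Computable.unpair))))
  have h2 := (TR.prec h0 h1).comp (TR.pair h0 (TR.of_computable Computable.id))
  refine h2.of_eq (fun n => ?_)
  cases n <;> simp

theorem CIn.comp [Encodable α] [Encodable β] [Encodable γ] {O} {f : β → γ} {g : α → β}
    (hf : CIn O f) (hg : CIn O g) : CIn O (fun a => f (g a)) := by
  refine (TR.comp (TR.optlift hf) hg).of_eq (fun n => ?_)
  simp only [fnOracle]
  cases (Encodable.decode n : Option α) <;> simp

theorem CIn.pair [Encodable α] [Encodable β] [Encodable γ] {O} {f : α → β} {g : α → γ}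
    (hf : CIn O f) (hg : CIn O g) : CIn O (fun a => (f a, g a)) := by
  have h : Computable (fun n : ℕ => (Nat.casesOn n.unpair.1 0
      (fun _ => Nat.pair (n.unpair.1 - 1) (n.unpair.2 - 1) + 1) : ℕ)) := by
    refine Primrec.to_comp ?_
    refine Primrec.nat_casesOn (Primrec.fst.comp Primrec.unpair) (Primrec.const 0) ?_
    refine Primrec.succ.comp (Primrec₂.natPair.comp ?_ ?_)
    · exact Primrec.pred.comp ((Primrec.fst.comp Primrec.unpair).comp Primrec.fst)
    · exact Primrec.pred.comp ((Primrec.snd.comp Primrec.unpair).comp Primrec.fst)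
  refine ((TR.of_computable h).comp (TR.pair hf hg)).of_eq (fun n => ?_)
  simp only [fnOracle]
  cases (Encodable.decode n : Option α) <;> simp

theorem CIn.id [Primcodable α] {O} : CIn O (fun a : α => a) := CIn.of_computable Computable.id
theorem CIn.fst [Primcodable α] [Primcodable β] {O} : CIn O (fun a : α × β => a.1) :=
  CIn.of_computable Computable.fst
theorem CIn.snd [Primcodable α] [Primcodable β] {O} : CIn O (fun a : α × β => a.2) :=
  CIn.of_computable Computable.snd
theorem CIn.const [Primcodable α] [Primcodable β] {O} (b : β) : CIn O (fun _ : α => b) :=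
  CIn.of_computable (Computable.const b)

theorem CIn.nat_rec [Primcodable α] [Primcodable β] {O} {f : α → β} {g : α × ℕ × β → β}
    (hf : CIn O f) (hg : CIn O g) :
    CIn O (fun p : α × ℕ => (Nat.rec (f p.1) (fun y i => g (p.1, y, i)) p.2 : β)) := by
  have hs : TR O (fun q => Nat.casesOn (q.unpair.2.unpair.2) 0
      (fun m => fnOracle g (Nat.pair q.unpair.1 (Nat.pair q.unpair.2.unpair.1 m)))) := by
    have h1 : Computable (fun q : ℕ => (Nat.casesOn (q.unpair.2.unpair.2) 0 (fun m =>
       (Nat.pair q.unpair.1 (Nat.pair q.unpair.2.unpair.1 m)) + 1) : ℕ)) := by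
      refine Primrec.to_comp ?_
      have a1 : Primrec (fun q : ℕ => q.unpair.1) := Primrec.fst.comp Primrec.unpair
      have a2 : Primrec (fun q : ℕ => q.unpair.2) := Primrec.snd.comp Primrec.unpair
      refine Primrec.nat_casesOn (a2.comp a2) (Primrec.const 0) ?_
      refine Primrec.succ.comp (Primrec₂.natPair.comp (a1.comp Primrec.fst)
        (Primrec₂.natPair.comp ((a1.comp a2).comp Primrec.fst) Primrec.snd))
    refine ((TR.optlift hg).comp (TR.of_computable h1)).of_eq (fun q => ?_)
    cases q.unpair.2.unpair.2 <;> simp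
  refine (TR.prec hf hs).of_eq (fun n => ?_)
  simp only [fnOracle, Encodable.decode_prod_val]
  cases h : (Encodable.decode n.unpair.1 : Option α) with
  | none =>
    simp only [Option.map_none, Option.bind_none, Encodable.encode_none]
    induction n.unpair.2 with
    | zero => rfl
    | succ k ih => simp only [ih]; simp
  | some a =>
    simp only [Encodable.decode_nat, Option.map_some, Option.bind_some]
    induction n.unpair.2 with
    | zero => rfl
    | succ k ih => simp only [ih]; simp [h]

/-- search -/
theorem CIn.search [Primcodable α] [Primcodable β] {O} {p : α × β → Bool} (hp : CIn O p)
    (h : ∀ a, ∃ b, p (a, b) = true) : ∃ f : α → β, CIn O f ∧ ∀ a, p (a, f a) = true := by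
  -- q (a,n) : n decodes to some b with p (a,b)
  have hex : ∀ a : α, ∃ n : ℕ, ∃ b, (Encodable.decode n : Option β) = some b ∧ p (a, b) = true := by
    intro a
    obtain ⟨b, hb⟩ := h a
    exact ⟨Encodable.encode b, b, by simp, hb⟩
  -- raw test function
  have hraw : TR O (fun q => (if (∃ a, (Encodable.decode q.unpair.1 : Option α) = some a) →
      ∃ a b, (Encodable.decode q.unpair.1 : Option α) = some a ∧
        (Encodable.decode q.unpair.2 : Option β) = some b ∧ p (a, b) = true then 0 else 1)) := by
    have h1 : TR O (fnOracle p) := hp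
    have h2 : TR O (fun q => Nat.pair (fnOracle p q) q) := TR.pair h1 (TR.of_computable Computable.id)
    have h3 : Computable (fun r : ℕ => (bif ((Encodable.decode r.unpair.2.unpair.1 : Option α).isSome
        && !(r.unpair.1 == 2)) then 1 else 0 : ℕ)) := by
      have a1 : Primrec (fun q : ℕ => q.unpair.1) := Primrec.fst.comp Primrec.unpair
      have a2 : Primrec (fun q : ℕ => q.unpair.2) := Primrec.snd.comp Primrec.unpair
      refine Computable.cond ?_ (Computable.const 1) (Computable.const 0)
      refine Primrec.to_comp (Primrec.and.comp ?_ (Primrec.not.comp ?_))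
      · exact Primrec.option_isSome.comp (Primrec.decode.comp (a1.comp a2))
      · exact Primrec.beq.comp a1 (Primrec.const 2)
    refine ((TR.of_computable h3).comp h2).of_eq (fun q => ?_)
    simp only [fnOracle, Nat.unpair_pair, Encodable.decode_prod_val]
    cases h5 : (Encodable.decode q.unpair.1 : Option α) with
    | none => simp
    | some a =>
      cases h6 : (Encodable.decode q.unpair.2 : Option β) with
      | none => simp
      | some b =>
        cases h7 : p (a, b) <;> simp [h7]
  let hfun : ℕ → ℕ := fun x => if hx : ∃ a, (Encodable.decode x : Option α) = some a then
    Nat.find (hex hx.choose) else 0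
  have hh : TR O hfun := by
    refine TR.rfind hraw (fun x => ?_)
    by_cases hx : ∃ a, (Encodable.decode x : Option α) = some a
    · have e1 := hx.choose_spec
      have e2 : hfun x = Nat.find (hex hx.choose) := by simp only [hfun, dif_pos hx]
      constructor
      · obtain ⟨b, hb1, hb2⟩ := Nat.find_spec (hex hx.choose)
        rw [if_pos]
        intro _
        refine ⟨hx.choose, b, ?_, ?_, hb2⟩
        · simpa using e1
        · rw [e2]; simpa using hb1
      · intro m hm
        rw [e2] at hm
        have := Nat.find_min _ hm
        rw [if_neg]
        · simp
        · simp only [Nat.unpair_pair]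
          intro hc
          obtain ⟨a, b, h1, h2, h3⟩ := hc hx
          rw [e1] at h1
          cases h1
          exact this ⟨b, h2, h3⟩
    · have e2 : hfun x = 0 := by simp only [hfun, dif_neg hx]
      rw [e2]
      refine ⟨?_, by simp⟩
      rw [if_pos]
      intro hc
      simp at hc
      exact absurd hc (by simpa using hx)
  have hsp : ∀ a : α, ∃ b, (Encodable.decode (hfun (Encodable.encode a)) : Option β) = some b ∧
      p (a, b) = true := by
    intro a
    have hx : ∃ a', (Encodable.decode (Encodable.encode a) : Option α) = some a' := ⟨a, by simp⟩
    have e1 := hx.choose_spec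
    have e0 : hx.choose = a := by
      have := e1.symm.trans (Encodable.encodek a)
      simpa using this
    have e2 : hfun (Encodable.encode a) = Nat.find (hex hx.choose) := by simp only [hfun, dif_pos hx]
    rw [e2]
    obtain ⟨b, hb1, hb2⟩ := Nat.find_spec (hex hx.choose)
    refine ⟨b, hb1, ?_⟩
    rw [e0] at hb2
    exact hb2
  choose f hf1 hf2 using hsp
  refine ⟨f, ?_, hf2⟩
  have h3 : Computable (fun r : ℕ => (bif ((Encodable.decode r.unpair.2 : Option α).isSome)
      then (Encodable.encode ((Encodable.decode r.unpair.1 : Option β))) else 0 : ℕ)) := by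
    have a1 : Primrec (fun q : ℕ => q.unpair.1) := Primrec.fst.comp Primrec.unpair
    have a2 : Primrec (fun q : ℕ => q.unpair.2) := Primrec.snd.comp Primrec.unpair
    refine Computable.cond ?_ ?_ (Computable.const 0)
    · exact Primrec.to_comp (Primrec.option_isSome.comp (Primrec.decode.comp a2))
    · exact Primrec.to_comp (Primrec.encode.comp (Primrec.decode.comp a1))
  -- normalise the code first
  have h4 : TR O (fun x => fnOracle (fun a : α => Encodable.encode a) x) :=
    CIn.of_computable (f := fun a : α => Encodable.encode a) Computable.encode
  have h5 := (TR.of_computable (O := O) h3).comp (TR.pair (hh.comp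
    ((TR.of_computable (O := O) (Primrec.to_comp Primrec.pred)).comp h4)) (TR.of_computable Computable.id))
  refine h5.of_eq (fun n => ?_)
  simp only [fnOracle, Nat.unpair_pair]
  cases h7 : (Encodable.decode n : Option α) with
  | none => simp [h7]
  | some a => simp [hf1 a, h7]

/-- bounded quantifier over a list -/
theorem CIn.ball [Primcodable α] [Primcodable β] {O} {p : α × β → Bool} {l : α → List β}
    (hl : CIn O l) (hp : CIn O p) : CIn O (fun a => (l a).all (fun b => p (a, b))) := by
  -- iterate over the list
  have hg : CIn O (fun x : α × ℕ × (List β × Bool) =>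
     (x.2.2.1.tail, x.2.2.2 && (bif x.2.2.1.head?.isSome then
       (Option.casesOn x.2.2.1.head? true (fun b => p (x.1, b)) : Bool) else true))) := by
    have hopt : CIn O (fun x : α × Option β => (Option.casesOn x.2 true (fun b => p (x.1, b)) : Bool)) := by
      by_cases hβ : Nonempty β
      · obtain ⟨b0⟩ := hβ
        have h1 : CIn O (fun x : α × Option β => p (x.1, x.2.getD b0)) :=
          hp.comp (CIn.of_primrec (Primrec.pair Primrec.fst
            (Primrec.option_getD.comp Primrec.snd (Primrec.const b0))))
        have h2 : CIn O (fun x : α × Option β => x.2.isNone || p (x.1, x.2.getD b0)) := by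
          have h3 : Primrec (fun x : (α × Option β) × Bool => x.1.2.isNone || x.2) :=
            Primrec.or.comp ((Primrec.not.comp (Primrec.option_isSome.comp
              (Primrec.snd.comp Primrec.fst))).of_eq (fun x => by cases x.1.2 <;> rfl)) Primrec.snd
          exact (CIn.of_primrec h3).comp (CIn.pair CIn.id h1)
        refine h2.of_eq (fun x => ?_)
        obtain ⟨a, _ | b⟩ := x <;> simp
      · refine (CIn.const true).of_eq (fun x => ?_)
        obtain ⟨a, _ | b⟩ := x
        · rfl
        · exact absurd ⟨b⟩ hβ
    have hd : CIn O (fun x : α × ℕ × (List β × Bool) => (Option.casesOn x.2.2.1.head? true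
        (fun b => p (x.1, b)) : Bool)) :=
      hopt.comp (g := fun x : α × ℕ × (List β × Bool) => (x.1, x.2.2.1.head?))
        (CIn.of_primrec (Primrec.pair Primrec.fst (Primrec.list_head?.comp (Primrec.fst.comp
          (Primrec.snd.comp Primrec.snd)))))
    have hpr : Primrec (fun y : (α × ℕ × (List β × Bool)) × Bool =>
        (y.1.2.2.1.tail, y.1.2.2.2 && y.2)) := by
      have h1 : Primrec (fun y : (α × ℕ × (List β × Bool)) × Bool => y.1.2.2) :=
        Primrec.snd.comp (Primrec.snd.comp Primrec.fst)
      exact Primrec.pair (Primrec.list_tail.comp (Primrec.fst.comp h1))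
        (Primrec.and.comp (Primrec.snd.comp h1) Primrec.snd)
    refine ((CIn.of_primrec hpr).comp (CIn.pair CIn.id hd)).of_eq (fun x => ?_)
    obtain ⟨a, n, _ | ⟨b, l⟩, c⟩ := x <;> simp
  have hf : CIn O (fun a : α => (l a, true)) := CIn.pair hl (CIn.const true)
  have hr := (CIn.nat_rec hf hg).comp (CIn.pair (CIn.id (α := α))
    ((CIn.of_primrec (Primrec.list_length (α := β))).comp hl))
  refine ((CIn.snd (α := List β) (β := Bool)).comp hr).of_eq (fun a => ?_)
  have key : ∀ n, (Nat.rec (l a, true) (fun y i => (i.1.tail, i.2 && (bif i.1.head?.isSome then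
       (Option.casesOn i.1.head? true (fun b => p (a, b)) : Bool) else true))) n : List β × Bool)
       = ((l a).drop n, ((l a).take n).all (fun b => p (a, b))) := by
    intro n
    induction n with
    | zero => simp
    | succ n ih =>
      simp only [ih]
      simp only [List.tail_drop, List.head?_drop, List.take_add_one, List.all_append]
      cases (l a)[n]? <;> simp
  have := key (l a).length
  simp only [List.take_length] at this
  exact congrArg Prod.snd this

end CIn

end Part1

section Part2

/-! ### Codes, s-m-n and the jump -/

theorem exists_ocode {O : ℕ → ℕ} {f : ℕ →. ℕ} (h : RecIn O f) : ∃ c, evalo O c = f := by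
  induction h with
  | oracle => exact ⟨.oracle, rfl⟩
  | zero => exact ⟨.zero, rfl⟩
  | succ => exact ⟨.succ, rfl⟩
  | left => exact ⟨.left, rfl⟩
  | right => exact ⟨.right, rfl⟩
  | pair _ _ h1 h2 =>
    obtain ⟨c, rfl⟩ := h1; obtain ⟨d, rfl⟩ := h2
    exact ⟨.pair c d, rfl⟩
  | comp _ _ h1 h2 =>
    obtain ⟨c, rfl⟩ := h1; obtain ⟨d, rfl⟩ := h2
    exact ⟨.comp c d, rfl⟩
  | prec _ _ h1 h2 =>
    obtain ⟨c, rfl⟩ := h1; obtain ⟨d, rfl⟩ := h2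
    exact ⟨.prec c d, rfl⟩
  | rfind _ h1 =>
    obtain ⟨c, rfl⟩ := h1
    refine ⟨.comp (.rfind' c) (.pair (.pair .left .right) .zero), ?_⟩
    funext a
    simp [evalo, Seq.seq, Part.map_id']

theorem bodd_div2_four (p r : ℕ) (hr : r < 4) : (4 * p + r).div2.div2 = p := by
  simp only [Nat.div2_val]; omega

theorem ofNatOCode_pair (a b : ℕ) :
    ofNatOCode (4 * Nat.pair a b + 5) = .pair (ofNatOCode a) (ofNatOCode b) := by
  have h1 : (4 * Nat.pair a b).div2.div2 = Nat.pair a b := by simp only [Nat.div2_val]; omega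
  have h2 : (4 * Nat.pair a b).bodd = false := by
    rw [show 4 * Nat.pair a b = 2 * (2 * Nat.pair a b) by ring]; simp
  have h3 : (4 * Nat.pair a b).div2.bodd = false := by
    rw [show (4 * Nat.pair a b).div2 = 2 * Nat.pair a b by rw [Nat.div2_val]; omega]; simp
  rw [ofNatOCode, h1, h2, h3, Nat.unpair_pair]

theorem ofNatOCode_comp (a b : ℕ) :
    ofNatOCode (4 * Nat.pair a b + 2 + 5) = .comp (ofNatOCode a) (ofNatOCode b) := by
  have h1 : (4 * Nat.pair a b + 2).div2.div2 = Nat.pair a b := by simp only [Nat.div2_val]; omega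
  have h2 : (4 * Nat.pair a b + 2).bodd = false := by
    rw [show 4 * Nat.pair a b + 2 = 2 * (2 * Nat.pair a b + 1) by ring]; simp
  have h3 : (4 * Nat.pair a b + 2).div2.bodd = true := by
    rw [show (4 * Nat.pair a b + 2).div2 = 2 * Nat.pair a b + 1 by rw [Nat.div2_val]; omega]; simp
  rw [ofNatOCode, h1, h2, h3, Nat.unpair_pair]

theorem ofNatOCode_prec (a b : ℕ) :
    ofNatOCode (4 * Nat.pair a b + 1 + 5) = .prec (ofNatOCode a) (ofNatOCode b) := by
  have h1 : (4 * Nat.pair a b + 1).div2.div2 = Nat.pair a b := by simp only [Nat.div2_val]; omega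
  have h2 : (4 * Nat.pair a b + 1).bodd = true := by
    rw [show 4 * Nat.pair a b + 1 = 2 * (2 * Nat.pair a b) + 1 by ring]; simp
  have h3 : (4 * Nat.pair a b + 1).div2.bodd = false := by
    rw [show (4 * Nat.pair a b + 1).div2 = 2 * Nat.pair a b by rw [Nat.div2_val]; omega]; simp
  rw [ofNatOCode, h1, h2, h3, Nat.unpair_pair]

theorem ofNatOCode_rfind (a : ℕ) :
    ofNatOCode (4 * a + 3 + 5) = .rfind' (ofNatOCode a) := by
  have h1 : (4 * a + 3).div2.div2 = a := by simp only [Nat.div2_val]; omega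
  have h2 : (4 * a + 3).bodd = true := by
    rw [show 4 * a + 3 = 2 * (2 * a + 1) + 1 by ring]; simp
  have h3 : (4 * a + 3).div2.bodd = true := by
    rw [show (4 * a + 3).div2 = 2 * a + 1 by rw [Nat.div2_val]; omega]; simp
  rw [ofNatOCode, h1, h2, h3]

theorem ofNatOCode_surj (c : OCode) : ∃ e, ofNatOCode e = c := by
  induction c with
  | zero => exact ⟨0, by rw [ofNatOCode]⟩
  | succ => exact ⟨1, by rw [ofNatOCode]⟩
  | left => exact ⟨2, by rw [ofNatOCode]⟩
  | right => exact ⟨3, by rw [ofNatOCode]⟩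
  | oracle => exact ⟨4, by rw [ofNatOCode]⟩
  | pair a b ha hb =>
    obtain ⟨a, rfl⟩ := ha; obtain ⟨b, rfl⟩ := hb; exact ⟨_, ofNatOCode_pair a b⟩
  | comp a b ha hb =>
    obtain ⟨a, rfl⟩ := ha; obtain ⟨b, rfl⟩ := hb; exact ⟨_, ofNatOCode_comp a b⟩
  | prec a b ha hb =>
    obtain ⟨a, rfl⟩ := ha; obtain ⟨b, rfl⟩ := hb; exact ⟨_, ofNatOCode_prec a b⟩
  | rfind' a ha =>
    obtain ⟨a, rfl⟩ := ha; exact ⟨_, ofNatOCode_rfind a⟩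

/-- index of the constant code -/
def constIdx : ℕ → ℕ := fun n => Nat.rec 0 (fun _ i => 4 * Nat.pair 1 i + 2 + 5) n

theorem constIdx_primrec : Primrec constIdx := by
  refine Primrec.nat_rec₁ 0 ?_
  have h : Primrec (fun i : ℕ => 4 * Nat.pair 1 i + 2 + 5) :=
    Primrec.nat_add.comp (Primrec.nat_add.comp (Primrec.nat_mul.comp (Primrec.const 4)
      (Primrec₂.natPair.comp (Primrec.const 1) Primrec.id)) (Primrec.const 2)) (Primrec.const 5)
  exact h.comp Primrec.snd

theorem evalo_constIdx (O : ℕ → ℕ) (n x : ℕ) :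
    evalo O (ofNatOCode (constIdx n)) x = Part.some n := by
  induction n with
  | zero =>
    have : constIdx 0 = 0 := rfl
    rw [this, ofNatOCode]; rfl
  | succ n ih =>
    have : constIdx (n + 1) = 4 * Nat.pair 1 (constIdx n) + 2 + 5 := rfl
    rw [this, ofNatOCode_comp]
    simp only [evalo, ih]
    rw [show ofNatOCode 1 = .succ by rw [ofNatOCode]]
    simp [evalo]

theorem jump_reduce {A : Set ℕ} {f : ℕ →. ℕ} (hf : RecIn (chi A) f) :
    ∃ g : ℕ → ℕ, Primrec g ∧ ∀ x, g x ∈ jump A ↔ (f x).Dom := by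
  obtain ⟨c, rfl⟩ := exists_ocode hf
  obtain ⟨e, rfl⟩ := ofNatOCode_surj c
  refine ⟨fun x => 4 * Nat.pair e (constIdx x) + 2 + 5, ?_, fun x => ?_⟩
  · exact Primrec.nat_add.comp (Primrec.nat_add.comp (Primrec.nat_mul.comp (Primrec.const 4)
      (Primrec₂.natPair.comp (Primrec.const e) constIdx_primrec)) (Primrec.const 2))
      (Primrec.const 5)
  · simp only [jump, Phi, Set.mem_ofPred_eq]
    rw [ofNatOCode_comp]
    have : evalo (chi A) (.comp (ofNatOCode e) (ofNatOCode (constIdx x)))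
        (4 * Nat.pair e (constIdx x) + 2 + 5) = evalo (chi A) (ofNatOCode e) x := by
      simp only [evalo, evalo_constIdx]
      exact Part.bind_some _ _
    rw [this]

theorem CIn.to_TR {O : ℕ → ℕ} {f : ℕ → ℕ} (h : CIn O f) : TR O f := by
  refine (TR.comp (TR.of_computable (Primrec.to_comp Primrec.pred)) h).of_eq (fun n => ?_)
  simp [fnOracle]

/-- existential questions about a low set are decidable from `K` -/
theorem low_decide {α : Type} [Primcodable α] {L : Set ℕ} (hL : Low L) {p : α × ℕ → Bool}
    (hp : CIn (chi L) p) : CIn (chi K) (fun a => decide (∃ k, p (a, k) = true)) := by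
  -- raw test
  have h1 : TR (chi L) (fun q => 2 - fnOracle p q) := by
    have : Primrec (fun m : ℕ => 2 - m) := Primrec.nat_sub.comp (Primrec.const 2) Primrec.id
    exact (TR.of_computable this.to_comp).comp hp
  have h2 := RecIn.rfind h1
  obtain ⟨g, hg, hgd⟩ := jump_reduce h2
  have hdom : ∀ a : α, g (Encodable.encode a) ∈ jump L ↔ ∃ k, p (a, k) = true := by
    intro a
    rw [hgd]
    refine (Nat.rfind_dom).trans ?_
    constructor
    · rintro ⟨n, hn, -⟩
      refine ⟨n, ?_⟩
      simp [fnOracle] at hn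
      cases h : p (a, n)
      · rw [h] at hn; simp at hn
      · rfl
    · rintro ⟨n, hn⟩
      refine ⟨n, ?_, by simp⟩
      simp [fnOracle, hn]
  have h3 : TR (chi K) (fun n => chi (jump L) (g n)) :=
    TR.comp (f := chi (jump L)) hL (TR.of_computable hg.to_comp)
  have h4 : CIn (chi K) (fun a : α => Encodable.encode a) := CIn.of_computable Computable.encode
  have h5 : CIn (chi K) (fun n => chi (jump L) (g n)) := by
    refine (TR.comp (TR.of_computable (Primrec.to_comp Primrec.succ)) h3).of_eq (fun n => ?_)
    simp [fnOracle]
  have h6 : Primrec (fun n : ℕ => n == 1) := Primrec.beq.comp Primrec.id (Primrec.const 1)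
  refine ((CIn.of_primrec h6).comp (h5.comp h4)).of_eq (fun a => ?_)
  by_cases hk : ∃ k, p (a, k) = true
  · have := (hdom a).2 hk
    simp [chi, this, hk]
  · have := (hdom a).not.2 hk
    simp only [chi, this]
    simp [hk]

theorem low_decide' {α : Type} [Primcodable α] {L : Set ℕ} (hL : Low L) {p : α → Bool}
    (hp : CIn (chi L) p) : CIn (chi K) p := by
  refine (low_decide hL (p := fun x : α × ℕ => p x.1) (hp.comp CIn.fst)).of_eq (fun a => ?_)
  simp

theorem seg_zero (A : Set ℕ) : seg A 0 = [] := rfl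

theorem seg_succ (A : Set ℕ) (n : ℕ) : seg A (n + 1) = seg A n ++ [decide (n ∈ A)] := by
  simp only [seg, List.range_succ, List.map_append, List.map_cons, List.map_nil]
  by_cases h : n ∈ A <;> simp [h]

@[simp] theorem seg_length (A : Set ℕ) (n : ℕ) : (seg A n).length = n := by simp [seg]

theorem seg_take (A : Set ℕ) {m n : ℕ} (h : m ≤ n) : (seg A n).take m = seg A m := by
  simp only [seg, ← List.map_take, List.take_range, min_eq_left h]

theorem seg_CIn (A : Set ℕ) : CIn (chi A) (fun n => seg A n) := by
  have h1 : CIn (chi A) (chi A) := by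
    refine (TR.comp (TR.of_computable (Primrec.to_comp Primrec.succ))
      (RecIn.oracle : TR (chi A) (chi A))).of_eq (fun n => ?_)
    simp [fnOracle]
  have h2 : Primrec (fun x : (ℕ × ℕ × List Bool) × ℕ => x.1.2.2 ++ [x.2 == 1]) :=
    Primrec.list_append.comp (Primrec.snd.comp (Primrec.snd.comp Primrec.fst))
      (Primrec.list_cons.comp (Primrec.beq.comp Primrec.snd (Primrec.const 1)) (Primrec.const []))
  have h3 : CIn (chi A) (fun x : ℕ × ℕ × List Bool => x.2.2 ++ [chi A x.2.1 == 1]) :=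
    (CIn.of_primrec h2).comp (CIn.pair CIn.id (h1.comp (CIn.of_primrec (Primrec.fst.comp Primrec.snd))))
  have h4 := (CIn.nat_rec (CIn.const (α := ℕ) ([] : List Bool)) h3).comp
    (CIn.pair (CIn.const (α := ℕ) 0) CIn.id)
  refine h4.of_eq (fun n => ?_)
  induction n with
  | zero => rfl
  | succ n ih =>
    rw [seg_succ, ← ih]
    by_cases h : n ∈ A <;> simp [h, chi]

end Part2

section Part3
set_option linter.unusedSimpArgs false
open Nat.Partrec (Code)

/-! ### Translating oracle codes to ordinary codes with a finite oracle string -/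

theorem exists_oracleCode : ∃ c : Code, ∀ (w : List Bool) (n : ℕ),
    c.eval (Nat.pair (Encodable.encode w) n) =
      Part.ofOption ((w[n]?).map (fun b => cond b 1 0)) := by
  have h : Computable (fun p : ℕ => ((Encodable.decode p.unpair.1 : Option (List Bool)).bind
      (fun w => w[p.unpair.2]?)).map (fun b => (cond b 1 0 : ℕ))) := by
    refine Primrec.to_comp ?_
    refine Primrec.option_map (Primrec.option_bind
      (Primrec.decode.comp (Primrec.fst.comp Primrec.unpair)) ?_) ?_
    · exact Primrec.list_getElem?.comp Primrec.snd
        ((Primrec.snd.comp Primrec.unpair).comp Primrec.fst)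
    · exact Primrec.cond Primrec.snd (Primrec.const 1) (Primrec.const 0)
  obtain ⟨c, hc⟩ := Code.exists_code.1 (Partrec.nat_iff.1 h.ofOption)
  refine ⟨c, fun w n => ?_⟩
  rw [hc]
  simp

noncomputable def oracleCode : Code := Classical.choose exists_oracleCode

theorem oracleCode_spec (w : List Bool) (n : ℕ) :
    oracleCode.eval (Nat.pair (Encodable.encode w) n) =
      Part.ofOption ((w[n]?).map (fun b => cond b 1 0)) :=
  Classical.choose_spec exists_oracleCode w n

/-- `(w,(a,m)) ↦ ((w,a),m)` -/
def codeIn : Code := .pair (.pair .left (.comp .left .right)) (.comp .right .right)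
/-- `((w,a),z) ↦ (w,(a,z))` -/
def codeOut : Code := .pair (.comp .left .left) (.pair (.comp .right .left) .right)

theorem ev_comp (a b : Code) (p : ℕ) :
    (Code.comp a b).eval p = (b.eval p).bind (fun y => a.eval y) := rfl
theorem ev_pair (a b : Code) (p : ℕ) :
    (Code.pair a b).eval p = (a.eval p).bind (fun y => (b.eval p).map (Nat.pair y)) := by
  simp [Code.eval, Seq.seq]
theorem ev_left (p : ℕ) : Code.left.eval p = Part.some p.unpair.1 := rfl
theorem ev_right (p : ℕ) : Code.right.eval p = Part.some p.unpair.2 := rfl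
theorem ev_succ (p : ℕ) : Code.succ.eval p = Part.some (p + 1) := rfl
theorem ev_zero (p : ℕ) : Code.zero.eval p = Part.some 0 := rfl

theorem codeIn_eval (w a m : ℕ) :
    codeIn.eval (Nat.pair w (Nat.pair a m)) = Part.some (Nat.pair (Nat.pair w a) m) := by
  simp [codeIn, ev_comp, ev_pair, ev_left, ev_right, ev_succ, ev_zero]

theorem codeOut_eval (w a m : ℕ) :
    codeOut.eval (Nat.pair (Nat.pair w a) m) = Part.some (Nat.pair w (Nat.pair a m)) := by
  simp [codeOut, ev_comp, ev_pair, ev_left, ev_right, ev_succ, ev_zero]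

def trPair (a b : Code) : Code := .pair a b
def trComp (a b : Code) : Code := .comp a (.pair .left b)
def trPrec (a b : Code) : Code := .comp (.prec a (.comp b codeOut)) codeIn
def trRfind (a : Code) : Code := .comp (.rfind' (.comp a codeOut)) codeIn

noncomputable def tr : OCode → Code
  | .zero => .zero
  | .succ => .comp .succ .right
  | .left => .comp .left .right
  | .right => .comp .right .right
  | .oracle => oracleCode
  | .pair a b => trPair (tr a) (tr b)
  | .comp a b => trComp (tr a) (tr b)
  | .prec a b => trPrec (tr a) (tr b)
  | .rfind' a => trRfind (tr a)

theorem trPair_eval (a b : Code) (p : ℕ) :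
    (trPair a b).eval p = Nat.pair <$> a.eval p <*> b.eval p := rfl

theorem trComp_eval (a b : Code) (w n : ℕ) :
    (trComp a b).eval (Nat.pair w n) =
      (b.eval (Nat.pair w n)).bind (fun y => a.eval (Nat.pair w y)) := by
  simp [trComp, ev_comp, ev_pair, ev_left, ev_right, ev_succ, ev_zero]

theorem trPrec_eval (a b : Code) (w x k : ℕ) :
    (trPrec a b).eval (Nat.pair w (Nat.pair x k)) =
      (Nat.rec (a.eval (Nat.pair w x)) (fun y IH => IH.bind fun i =>
        b.eval (Nat.pair w (Nat.pair x (Nat.pair y i)))) k : Part ℕ) := by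
  have h : (trPrec a b).eval (Nat.pair w (Nat.pair x k)) =
    (Code.prec a (.comp b codeOut)).eval (Nat.pair (Nat.pair w x) k) := by
    simp only [trPrec, Code.eval, codeIn_eval]
    exact Part.bind_some _ _
  rw [h]
  induction k with
  | zero => rw [Code.eval_prec_zero]; rfl
  | succ k ih =>
    rw [Code.eval_prec_succ]
    simp only [← ih (by simp only [trPrec, Code.eval, codeIn_eval]; exact Part.bind_some _ _)]
    simp only [Code.eval, codeOut_eval]
    congr 1
    funext i
    exact Part.bind_some _ _

theorem trRfind_eval (a : Code) (w x m : ℕ) :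
    (trRfind a).eval (Nat.pair w (Nat.pair x m)) =
      (Nat.rfind fun n => (fun z => decide (z = 0)) <$>
        a.eval (Nat.pair w (Nat.pair x (n + m)))).map (· + m) := by
  have h : (trRfind a).eval (Nat.pair w (Nat.pair x m)) =
    (Code.rfind' (.comp a codeOut)).eval (Nat.pair (Nat.pair w x) m) := by
    simp only [trRfind, Code.eval, codeIn_eval]
    exact Part.bind_some _ _
  rw [h]
  simp only [Code.eval, codeOut_eval, Nat.unpaired, Nat.unpair_pair]
  congr 1
  congr 1
  funext n
  congr 1
  exact Part.bind_some _ _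

theorem mem_pair_seq {a b : Part ℕ} {x : ℕ} :
    x ∈ (Nat.pair <$> a <*> b) ↔ ∃ y ∈ a, ∃ z ∈ b, x = Nat.pair y z := by
  simp [Seq.seq, eq_comm]

theorem seg_getElem? (A : Set ℕ) (m n : ℕ) :
    (seg A m)[n]? = if n < m then some (decide (n ∈ A)) else none := by
  unfold seg
  by_cases h : n < m
  · by_cases h2 : n ∈ A <;> simp [h, h2]
  · simp [h]

theorem tr_sound (A : Set ℕ) (m : ℕ) (c : OCode) : ∀ n x,
    x ∈ (tr c).eval (Nat.pair (Encodable.encode (seg A m)) n) → x ∈ evalo (chi A) c n := by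
  induction c with
  | zero => intro n x h; simpa [tr, evalo, ev_comp, ev_pair, ev_left, ev_right, ev_succ, ev_zero] using h
  | succ => intro n x h; simpa [tr, evalo, ev_comp, ev_pair, ev_left, ev_right, ev_succ, ev_zero] using h
  | left => intro n x h; simpa [tr, evalo, ev_comp, ev_pair, ev_left, ev_right, ev_succ, ev_zero] using h
  | right => intro n x h; simpa [tr, evalo, ev_comp, ev_pair, ev_left, ev_right, ev_succ, ev_zero] using h
  | oracle =>
    intro n x h
    simp only [tr, oracleCode_spec, seg_getElem?] at h
    by_cases h1 : n < m
    · by_cases h2 : n ∈ A <;> simpa [evalo, chi, h1, h2] using h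
    · simp [h1] at h
  | pair a b ha hb =>
    intro n x h
    rw [tr, trPair_eval, mem_pair_seq] at h
    obtain ⟨y, hy, z, hz, rfl⟩ := h
    exact mem_pair_seq.2 ⟨y, ha _ _ hy, z, hb _ _ hz, rfl⟩
  | comp a b ha hb =>
    intro n x h
    rw [tr, trComp_eval, Part.mem_bind_iff] at h
    obtain ⟨y, hy, hz⟩ := h
    exact Part.mem_bind_iff.2 ⟨y, hb _ _ hy, ha _ _ hz⟩
  | prec a b ha hb =>
    intro n
    obtain ⟨u, k, rfl⟩ : ∃ u k, n = Nat.pair u k := ⟨_, _, (Nat.pair_unpair n).symm⟩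
    simp only [tr, trPrec_eval, evalo, Nat.unpaired, Nat.unpair_pair]
    induction k with
    | zero => intro x h; exact ha _ _ h
    | succ k ih =>
      intro x h
      obtain ⟨y, hy, hz⟩ := Part.mem_bind_iff.1 h
      exact Part.mem_bind_iff.2 ⟨y, ih _ hy, hb _ _ hz⟩
  | rfind' a ha =>
    intro n x
    obtain ⟨u, k, rfl⟩ : ∃ u k, n = Nat.pair u k := ⟨_, _, (Nat.pair_unpair n).symm⟩
    simp only [tr, trRfind_eval, evalo, Nat.unpaired, Nat.unpair_pair]
    intro h
    obtain ⟨y, hy, rfl⟩ := (Part.mem_map_iff _).1 h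
    refine (Part.mem_map_iff _).2 ⟨y, ?_, rfl⟩
    obtain ⟨h1, h2⟩ := Nat.mem_rfind.1 hy
    refine Nat.mem_rfind.2 ⟨?_, fun {j} hj => ?_⟩
    · obtain ⟨z, hz, hz2⟩ := (Part.mem_map_iff _).1 h1
      exact (Part.mem_map_iff _).2 ⟨z, ha _ _ hz, hz2⟩
    · obtain ⟨z, hz, hz2⟩ := (Part.mem_map_iff _).1 (h2 hj)
      exact (Part.mem_map_iff _).2 ⟨z, ha _ _ hz, hz2⟩

theorem tr_complete (A : Set ℕ) (c : OCode) : ∀ n x, x ∈ evalo (chi A) c n →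
    ∀ᶠ m in Filter.atTop, x ∈ (tr c).eval (Nat.pair (Encodable.encode (seg A m)) n) := by
  induction c with
  | zero => intro n x h; refine Filter.Eventually.of_forall fun m => ?_
            simpa [tr, evalo, ev_comp, ev_pair, ev_left, ev_right, ev_succ, ev_zero] using h
  | succ => intro n x h; refine Filter.Eventually.of_forall fun m => ?_
            simpa [tr, evalo, ev_comp, ev_pair, ev_left, ev_right, ev_succ, ev_zero] using h
  | left => intro n x h; refine Filter.Eventually.of_forall fun m => ?_
            simpa [tr, evalo, ev_comp, ev_pair, ev_left, ev_right, ev_succ, ev_zero] using h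
  | right => intro n x h; refine Filter.Eventually.of_forall fun m => ?_
             simpa [tr, evalo, ev_comp, ev_pair, ev_left, ev_right, ev_succ, ev_zero] using h
  | oracle =>
    intro n x h
    filter_upwards [Filter.eventually_gt_atTop n] with m h1
    simp only [tr, oracleCode_spec, seg_getElem?]
    by_cases h2 : n ∈ A <;> simpa [evalo, chi, h1, h2] using h
  | pair a b ha hb =>
    intro n x h
    obtain ⟨y, hy, z, hz, rfl⟩ := mem_pair_seq.1 h
    filter_upwards [ha _ _ hy, hb _ _ hz] with m h1 h2
    rw [tr, trPair_eval, mem_pair_seq]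
    exact ⟨y, h1, z, h2, rfl⟩
  | comp a b ha hb =>
    intro n x h
    obtain ⟨y, hy, hz⟩ := Part.mem_bind_iff.1 h
    filter_upwards [hb _ _ hy, ha _ _ hz] with m h1 h2
    rw [tr, trComp_eval, Part.mem_bind_iff]
    exact ⟨y, h1, h2⟩
  | prec a b ha hb =>
    intro n
    obtain ⟨u, k, rfl⟩ : ∃ u k, n = Nat.pair u k := ⟨_, _, (Nat.pair_unpair n).symm⟩
    simp only [tr, trPrec_eval, evalo, Nat.unpaired, Nat.unpair_pair]
    induction k with
    | zero => intro x h; exact ha _ _ h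
    | succ k ih =>
      intro x h
      obtain ⟨y, hy, hz⟩ := Part.mem_bind_iff.1 h
      filter_upwards [ih _ hy, hb _ _ hz] with m h1 h2
      exact Part.mem_bind_iff.2 ⟨y, h1, h2⟩
  | rfind' a ha =>
    intro n x
    obtain ⟨u, k, rfl⟩ : ∃ u k, n = Nat.pair u k := ⟨_, _, (Nat.pair_unpair n).symm⟩
    simp only [tr, trRfind_eval, evalo, Nat.unpaired, Nat.unpair_pair]
    intro h
    obtain ⟨y, hy, rfl⟩ := (Part.mem_map_iff _).1 h
    obtain ⟨h1, h2⟩ := Nat.mem_rfind.1 hy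
    have e2 : ∀ᶠ m in Filter.atTop, ∀ j ∈ Finset.range y, false ∈ ((fun z => decide (z = 0)) <$>
        (tr a).eval (Nat.pair (Encodable.encode (seg A m)) (Nat.pair u (j + k))) : Part Bool) := by
      rw [Filter.eventually_all_finset]
      intro j hj
      obtain ⟨z, hz, hz2⟩ := (Part.mem_map_iff _).1 (h2 (Finset.mem_range.1 hj))
      filter_upwards [ha _ _ hz] with m h3
      exact (Part.mem_map_iff _).2 ⟨z, h3, hz2⟩
    obtain ⟨z, hz, hz2⟩ := (Part.mem_map_iff _).1 h1
    filter_upwards [e2, ha _ _ hz] with m h3 h4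
    refine (Part.mem_map_iff _).2 ⟨y, ?_, rfl⟩
    refine Nat.mem_rfind.2 ⟨?_, fun {j} hj => h3 j (Finset.mem_range.2 hj)⟩
    exact (Part.mem_map_iff _).2 ⟨z, h4, hz2⟩

end Part3

section Part4
open Nat.Partrec (Code)

noncomputable def trStep (n : ℕ) (x y z : Code) : Code :=
  if n = 0 then .zero else if n = 1 then .comp .succ .right else if n = 2 then .comp .left .right
  else if n = 3 then .comp .right .right else if n = 4 then oracleCode
  else cond (n - 5).bodd (cond (n - 5).div2.bodd (trRfind z) (trPrec x y))
    (cond (n - 5).div2.bodd (trComp x y) (trPair x y))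

theorem trStep_eq (n : ℕ) : tr (ofNatOCode n) = trStep n
    (tr (ofNatOCode (n - 5).div2.div2.unpair.1)) (tr (ofNatOCode (n - 5).div2.div2.unpair.2))
    (tr (ofNatOCode (n - 5).div2.div2)) := by
  match n with
  | 0 => rw [ofNatOCode]; simp [trStep, tr]
  | 1 => rw [ofNatOCode]; simp [trStep, tr]
  | 2 => rw [ofNatOCode]; simp [trStep, tr]
  | 3 => rw [ofNatOCode]; simp [trStep, tr]
  | 4 => rw [ofNatOCode]; simp [trStep, tr]
  | n + 5 =>
    rw [ofNatOCode]
    cases h1 : n.bodd <;> cases h2 : n.div2.bodd <;> simp [trStep, h1, h2, tr]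

theorem trStep_primrec {α : Type} [Primcodable α] {n : α → ℕ} {x y z : α → Code}
    (hn : Primrec n) (hx : Primrec x) (hy : Primrec y) (hz : Primrec z) :
    Primrec (fun a => trStep (n a) (x a) (y a) (z a)) := by
  have hm : Primrec (fun a => n a - 5) := Primrec.nat_sub.comp hn (Primrec.const 5)
  unfold trStep
  refine Primrec.ite (Primrec.eq.comp hn (Primrec.const 0)) (Primrec.const _) ?_
  refine Primrec.ite (Primrec.eq.comp hn (Primrec.const 1)) (Primrec.const _) ?_
  refine Primrec.ite (Primrec.eq.comp hn (Primrec.const 2)) (Primrec.const _) ?_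
  refine Primrec.ite (Primrec.eq.comp hn (Primrec.const 3)) (Primrec.const _) ?_
  refine Primrec.ite (Primrec.eq.comp hn (Primrec.const 4)) (Primrec.const _) ?_
  have hb := Primrec.nat_bodd.comp (Primrec.nat_div2.comp hm)
  refine Primrec.cond (Primrec.nat_bodd.comp hm) (Primrec.cond hb ?_ ?_) (Primrec.cond hb ?_ ?_)
  · unfold trRfind
    exact Code.primrec₂_comp.comp (Code.primrec_rfind'.comp
      (Code.primrec₂_comp.comp hz (Primrec.const _))) (Primrec.const _)
  · unfold trPrec
    exact Code.primrec₂_comp.comp (Code.primrec₂_prec.comp hx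
      (Code.primrec₂_comp.comp hy (Primrec.const _))) (Primrec.const _)
  · unfold trComp
    exact Code.primrec₂_comp.comp hx (Code.primrec₂_pair.comp (Primrec.const _) hy)
  · unfold trPair
    exact Code.primrec₂_pair.comp hx hy

theorem tr_primrec : Primrec (fun e => tr (ofNatOCode e)) := by
  have h : Primrec₂ (fun (_ : Unit) (e : ℕ) => tr (ofNatOCode e)) := by
    refine Primrec.nat_strong_rec _ (g := fun _ l => some (trStep l.length
      (l.getD (l.length - 5).div2.div2.unpair.1 Code.zero)
      (l.getD (l.length - 5).div2.div2.unpair.2 Code.zero)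
      (l.getD (l.length - 5).div2.div2 Code.zero))) ?_ ?_
    · have hl : Primrec (fun p : Unit × List Code => p.2.length) :=
        Primrec.list_length.comp Primrec.snd
      have hd : Primrec (fun p : Unit × List Code => (p.2.length - 5).div2.div2) :=
        Primrec.nat_div2.comp (Primrec.nat_div2.comp (Primrec.nat_sub.comp hl (Primrec.const 5)))
      have hu := Primrec.unpair.comp hd
      refine Primrec.option_some.comp (trStep_primrec hl ?_ ?_ ?_)
      · exact (Primrec.list_getD _).comp Primrec.snd (Primrec.fst.comp hu)
      · exact (Primrec.list_getD _).comp Primrec.snd (Primrec.snd.comp hu)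
      · exact (Primrec.list_getD _).comp Primrec.snd hd
    · intro a n
      have hd : (n - 5).div2.div2 ≤ n - 5 := by
        rw [Nat.div2_val, Nat.div2_val]; omega
      have key : ∀ i, i ≤ n - 5 → n ≥ 5 →
        ((List.range n).map (fun e => tr (ofNatOCode e))).getD i Code.zero = tr (ofNatOCode i) := by
        intro i hi hn
        have : i < n := by omega
        simp [List.getD, this]
      simp only [List.length_map, List.length_range]
      congr 1
      rw [trStep_eq n]
      by_cases hn : 5 ≤ n
      · rw [key _ hd hn, key _ ((Nat.unpair_left_le _).trans hd) hn,
          key _ ((Nat.unpair_right_le _).trans hd) hn]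
      · have : n = 0 ∨ n = 1 ∨ n = 2 ∨ n = 3 ∨ n = 4 := by omega
        rcases this with rfl | rfl | rfl | rfl | rfl <;> simp [trStep]
  exact h.comp (Primrec.const ()) Primrec.id

/-- generic halting predicate -/
noncomputable def halts (c : Code) (n : ℕ) (w : List Bool) (sw : Bool) : Bool :=
  (List.range (w.length + 1)).any fun j => (Code.evaln w.length c
    (cond sw (Nat.pair n (Encodable.encode (w.take j)))
      (Nat.pair (Encodable.encode (w.take j)) n))).isSome

theorem halts_iff {c n w sw} : halts c n w sw = true ↔ ∃ j ≤ w.length, (Code.evaln w.length c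
    (cond sw (Nat.pair n (Encodable.encode (w.take j)))
      (Nat.pair (Encodable.encode (w.take j)) n))).isSome = true := by
  simp [halts, Nat.lt_succ_iff]

theorem halts_mono {c n w w' sw} (h : halts c n w sw = true) (hw : w <+: w') :
    halts c n w' sw = true := by
  rw [halts_iff] at *
  obtain ⟨j, hj, h⟩ := h
  obtain ⟨t, rfl⟩ := hw
  refine ⟨j, by simp; omega, ?_⟩
  rw [List.take_append_of_le_length hj]
  rw [Option.isSome_iff_exists] at *
  obtain ⟨x, hx⟩ := h
  exact ⟨x, Code.evaln_mono (by simp) hx⟩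

theorem list_take_primrec : Primrec₂ (fun (n : ℕ) (l : List Bool) => l.take n) := by
  have : Primrec₂ (fun (n : ℕ) (l : List Bool) =>
      ((List.range (min n l.length)).map (fun i => l.getD i false))) := by
    refine Primrec.list_map (Primrec.list_range.comp
      (Primrec.nat_min.comp Primrec.fst (Primrec.list_length.comp Primrec.snd))) ?_
    exact (Primrec.list_getD _).comp (Primrec.snd.comp Primrec.fst) Primrec.snd
  refine this.of_eq fun n l => ?_
  apply List.ext_getElem
  · simp
  · intro i h1 h2
    simp at h1 h2
    simp [List.getD, h1, h2]

theorem any_primrec {α β : Type} [Primcodable α] [Primcodable β] {l : α → List β}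
    {p : α → β → Bool} (hl : Primrec l) (hp : Primrec₂ p) :
    Primrec (fun a => (l a).any (p a)) := by
  have : Primrec (fun a => (l a).foldr (fun b s => p a b || s) false) := by
    refine Primrec.list_foldr (h := fun a q => p a q.1 || q.2) hl (Primrec.const false) ?_
    exact Primrec.or.comp (hp.comp Primrec.fst (Primrec.fst.comp Primrec.snd))
      (Primrec.snd.comp Primrec.snd)
  refine this.of_eq fun a => ?_
  induction l a with
  | nil => rfl
  | cons x t ih => simp [ih]

theorem halts_primrec {α : Type} [Primcodable α] {c : α → Code} {n : α → ℕ} {w : α → List Bool}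
    {sw : Bool} (hc : Primrec c) (hn : Primrec n) (hw : Primrec w) :
    Primrec (fun a => halts (c a) (n a) (w a) sw) := by
  unfold halts
  have hl : Primrec (fun a => (w a).length) := Primrec.list_length.comp hw
  refine any_primrec (Primrec.list_range.comp (Primrec.succ.comp hl)) ?_
  have ht : Primrec (fun p : α × ℕ => Encodable.encode ((w p.1).take p.2)) :=
    Primrec.encode.comp (list_take_primrec.comp Primrec.snd (hw.comp Primrec.fst))
  have hn' := hn.comp (Primrec.fst (α := α) (β := ℕ))
  refine Primrec.option_isSome.comp (Code.primrec_evaln.comp (Primrec.pair (Primrec.pair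
    (hl.comp Primrec.fst) (hc.comp Primrec.fst)) ?_))
  cases sw
  · exact Primrec₂.natPair.comp ht hn'
  · exact Primrec₂.natPair.comp hn' ht

noncomputable def G (e : ℕ) (w : List Bool) : Bool := halts (tr (ofNatOCode e)) e w false

theorem G_primrec : Primrec₂ G :=
  halts_primrec (tr_primrec.comp Primrec.fst) Primrec.fst Primrec.snd

theorem G_mono {e w w'} (h : G e w = true) (hw : w <+: w') : G e w' = true := halts_mono h hw

theorem seg_prefix (A : Set ℕ) {m n : ℕ} (h : m ≤ n) : seg A m <+: seg A n := by
  rw [← seg_take A h]; exact List.take_prefix _ _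

theorem evaln_isSome_of_mem {c : Code} {p x : ℕ} (h : x ∈ c.eval p) :
    ∃ k0, ∀ k ≥ k0, (Code.evaln k c p).isSome = true := by
  obtain ⟨k0, hk⟩ := Code.evaln_complete.1 h
  exact ⟨k0, fun k hk' => Option.isSome_iff_exists.2 ⟨x, Code.evaln_mono hk' hk⟩⟩

theorem mem_jump_iff (A : Set ℕ) (e : ℕ) : e ∈ jump A ↔ ∃ n, G e (seg A n) = true := by
  constructor
  · intro h
    obtain ⟨x, hx⟩ := Part.dom_iff_mem.1 (show (evalo (chi A) (ofNatOCode e) e).Dom from h)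
    obtain ⟨m, hm⟩ := (tr_complete A _ _ _ hx).exists
    obtain ⟨k0, hk⟩ := evaln_isSome_of_mem hm
    refine ⟨max m k0, halts_iff.2 ⟨m, by simp, ?_⟩⟩
    rw [seg_take A (le_max_left _ _)]
    exact hk _ (by simp)
  · rintro ⟨n, hn⟩
    obtain ⟨j, hj, h⟩ := halts_iff.1 hn
    rw [seg_length] at hj
    rw [seg_take A hj] at h
    obtain ⟨x, hx⟩ := Option.isSome_iff_exists.1 h
    exact Part.dom_iff_mem.2 ⟨x, tr_sound A j _ _ _ (Code.evaln_sound hx)⟩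

end Part4

section Part5
set_option linter.unusedSimpArgs false

def sumN (f : List Bool → ℕ) : List Bool → ℕ → ℕ
  | τ, 0 => f τ
  | τ, k + 1 => sumN f (τ ++ [false]) k + sumN f (τ ++ [true]) k

def cnt (P : List Bool → Bool) (τ : List Bool) (k : ℕ) : ℕ := sumN (fun ρ => (P ρ).toNat) τ k

def strs : ℕ → List (List Bool)
  | 0 => [[]]
  | k + 1 => (strs k).map (false :: ·) ++ (strs k).map (true :: ·)

theorem mem_strs {k : ℕ} {η : List Bool} : η ∈ strs k ↔ η.length = k := by
  induction k generalizing η with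
  | zero => simp [strs]
  | succ k ih =>
    cases η with
    | nil => simp [strs]
    | cons b η => cases b <;> simp [strs, ih]

theorem strs_nodup (k : ℕ) : (strs k).Nodup := by
  induction k with
  | zero => simp [strs]
  | succ k ih =>
    rw [strs, List.nodup_append]
    refine ⟨ih.map (fun a b h => by simpa using h), ih.map (fun a b h => by simpa using h), ?_⟩
    intro a ha b hb
    simp only [List.mem_map] at ha hb
    obtain ⟨x, -, rfl⟩ := ha
    obtain ⟨y, -, rfl⟩ := hb
    simp

theorem sumN_strs (f : List Bool → ℕ) (τ : List Bool) (k : ℕ) :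
    sumN f τ k = ((strs k).map (fun η => f (τ ++ η))).sum := by
  induction k generalizing τ with
  | zero => simp [sumN, strs]
  | succ k ih => simp [sumN, strs, ih, Function.comp_def]

theorem sumN_le {f g : List Bool → ℕ} {τ : List Bool} {k : ℕ}
    (h : ∀ η, η.length = k → f (τ ++ η) ≤ g (τ ++ η)) : sumN f τ k ≤ sumN g τ k := by
  induction k generalizing τ with
  | zero => simpa [sumN] using h [] rfl
  | succ k ih =>
    refine Nat.add_le_add (ih fun η hη => ?_) (ih fun η hη => ?_)
    · simpa using h (false :: η) (by simp [hη])
    · simpa using h (true :: η) (by simp [hη])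

theorem sumN_congr {f g : List Bool → ℕ} {τ : List Bool} {k : ℕ}
    (h : ∀ η, η.length = k → f (τ ++ η) = g (τ ++ η)) : sumN f τ k = sumN g τ k :=
  le_antisymm (sumN_le fun η hη => (h η hη).le) (sumN_le fun η hη => (h η hη).ge)

theorem sumN_add (f g : List Bool → ℕ) (τ : List Bool) (k : ℕ) :
    sumN (fun ρ => f ρ + g ρ) τ k = sumN f τ k + sumN g τ k := by
  induction k generalizing τ with
  | zero => rfl
  | succ k ih => simp only [sumN, ih]; omega

theorem sumN_mul (c : ℕ) (f : List Bool → ℕ) (τ : List Bool) (k : ℕ) :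
    sumN (fun ρ => c * f ρ) τ k = c * sumN f τ k := by
  induction k generalizing τ with
  | zero => rfl
  | succ k ih => simp only [sumN, ih]; ring

theorem sumN_const (c : ℕ) (τ : List Bool) (k : ℕ) : sumN (fun _ => c) τ k = c * 2 ^ k := by
  induction k generalizing τ with
  | zero => simp [sumN]
  | succ k ih => simp only [sumN, ih]; ring

theorem sumN_split (f : List Bool → ℕ) (τ : List Bool) (j k : ℕ) :
    sumN f τ (j + k) = sumN (fun ρ => sumN f ρ k) τ j := by
  induction j generalizing τ with
  | zero => simp [sumN]
  | succ j ih => rw [Nat.add_right_comm]; simp only [sumN, ih]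

theorem cnt_le (P : List Bool → Bool) (τ : List Bool) (k : ℕ) : cnt P τ k ≤ 2 ^ k := by
  have := sumN_const 1 τ k
  rw [one_mul] at this
  rw [← this]
  exact sumN_le fun η _ => Bool.toNat_le _

theorem cnt_mono {P Q : List Bool → Bool} {τ : List Bool} {k : ℕ}
    (h : ∀ η, η.length = k → P (τ ++ η) = true → Q (τ ++ η) = true) : cnt P τ k ≤ cnt Q τ k := by
  refine sumN_le fun η hη => ?_
  have := h η hη
  cases h1 : P (τ ++ η)
  · simp
  · simp [this h1]

theorem cnt_or {P Q R : List Bool → Bool} {τ : List Bool} {k : ℕ}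
    (h : ∀ η, η.length = k → P (τ ++ η) = true → Q (τ ++ η) = true ∨ R (τ ++ η) = true) :
    cnt P τ k ≤ cnt Q τ k + cnt R τ k := by
  rw [cnt, cnt, cnt, ← sumN_add]
  refine sumN_le fun η hη => ?_
  have := h η hη
  cases h1 : P (τ ++ η)
  · simp
  · rcases this h1 with h | h <;> simp [h]

theorem cnt_and {P Q R : List Bool → Bool} {τ : List Bool} {k : ℕ}
    (h : ∀ η, η.length = k → Q (τ ++ η) = true → R (τ ++ η) = false)
    (h1 : ∀ η, η.length = k → Q (τ ++ η) = true → P (τ ++ η) = true)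
    (h2 : ∀ η, η.length = k → R (τ ++ η) = true → P (τ ++ η) = true) :
    cnt Q τ k + cnt R τ k ≤ cnt P τ k := by
  rw [cnt, cnt, cnt, ← sumN_add]
  refine sumN_le fun η hη => ?_
  have a := h η hη; have b := h1 η hη; have c := h2 η hη
  cases hq : Q (τ ++ η) <;> cases hr : R (τ ++ η) <;> simp_all

def Mono (P : List Bool → Bool) : Prop := ∀ ρ b, P ρ = true → P (ρ ++ [b]) = true

theorem Mono.append {P} (h : Mono P) {ρ : List Bool} (hp : P ρ = true) (η : List Bool) :
    P (ρ ++ η) = true := by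
  induction η generalizing ρ with
  | nil => simpa
  | cons b η ih => simpa using ih (h ρ b hp)

theorem cnt_full {P} {τ : List Bool} {k : ℕ} (h : ∀ η, η.length = k → P (τ ++ η) = true) :
    cnt P τ k = 2 ^ k := by
  rw [← one_mul (2 ^ k), ← sumN_const 1 τ k]
  exact sumN_congr fun η hη => by simp [h η hη]

theorem cnt_none {P} {τ : List Bool} {k : ℕ} (h : ∀ η, η.length = k → P (τ ++ η) = false) :
    cnt P τ k = 0 := by
  rw [← zero_mul (2 ^ k), ← sumN_const 0 τ k]
  exact sumN_congr fun η hη => by simp [h η hη]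

theorem cnt_split (P : List Bool → Bool) (τ : List Bool) (j k : ℕ) :
    cnt P τ (j + k) = sumN (fun ρ => cnt P ρ k) τ j := sumN_split _ _ _ _

theorem Mono.cnt_add {P} (h : Mono P) (τ : List Bool) (j k : ℕ) :
    cnt P τ j * 2 ^ k ≤ cnt P τ (j + k) := by
  rw [cnt_split, mul_comm, cnt, ← sumN_mul]
  refine sumN_le fun η _ => ?_
  cases hp : P (τ ++ η)
  · simp
  · rw [cnt_full fun η' _ => h.append hp η']; simp

theorem cnt_succ (P : List Bool → Bool) (τ : List Bool) (k : ℕ) :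
    cnt P τ (k + 1) = cnt P (τ ++ [false]) k + cnt P (τ ++ [true]) k := rfl

/-! interleaving -/
def il (l ρ : List Bool) : List Bool :=
  (List.range ρ.length).flatMap fun i => [l.getD i false, ρ.getD i false]

theorem il_append {τ ρ : List Bool} (h : τ.length = ρ.length) (a b : Bool) :
    il (τ ++ [a]) (ρ ++ [b]) = il τ ρ ++ [a, b] := by
  unfold il
  rw [List.length_append, List.length_singleton, List.range_succ, List.flatMap_append]
  congr 1
  · rw [List.flatMap_def, List.flatMap_def]
    congr 1
    apply List.map_congr_left
    intro i hi
    have hi : i < ρ.length := List.mem_range.1 hi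
    have hi' : i < τ.length := h ▸ hi
    simp [List.getD, List.getElem?_append_left hi, List.getElem?_append_left hi']
  · simp [List.getD, ← h]

theorem il_primrec : Primrec₂ il := by
  refine Primrec.list_flatMap (Primrec.list_range.comp (Primrec.list_length.comp Primrec.snd)) ?_
  refine Primrec.list_cons.comp ?_ (Primrec.list_cons.comp ?_ (Primrec.const []))
  · exact (Primrec.list_getD _).comp (Primrec.fst.comp Primrec.fst) Primrec.snd
  · exact (Primrec.list_getD _).comp (Primrec.snd.comp Primrec.fst) Primrec.snd

theorem il_seg (L B : Set ℕ) (n : ℕ) : il (seg L n) (seg B n) = seg (join L B) (2 * n) := by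
  induction n with
  | zero => rfl
  | succ n ih =>
    rw [seg_succ, seg_succ, il_append (by simp), ih, Nat.mul_succ, seg_succ, seg_succ]
    have h1 : decide (n ∈ L) = decide (2 * n ∈ join L B) := by
      rw [decide_eq_decide]
      constructor
      · intro h; exact Or.inl ⟨n, h, rfl⟩
      · rintro (⟨a, h, e⟩ | ⟨a, h, e⟩)
        · have : n = a := by omega
          exact this ▸ h
        · omega
    have h2 : decide (n ∈ B) = decide (2 * n + 1 ∈ join L B) := by
      rw [decide_eq_decide]
      constructor
      · intro h; exact Or.inr ⟨n, h, rfl⟩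
      · rintro (⟨a, h, e⟩ | ⟨a, h, e⟩)
        · omega
        · have : n = a := by omega
          exact this ▸ h
    rw [h1, h2]; simp

theorem sumN_il (f : List Bool → ℕ) (t : ℕ) : ∀ τ ρ : List Bool, τ.length = ρ.length →
    sumN (fun τ' => sumN (fun ρ' => f (il τ' ρ')) ρ t) τ t = sumN f (il τ ρ) (2 * t) := by
  induction t with
  | zero => intro τ ρ _; rfl
  | succ t ih =>
    intro τ ρ h
    have e : ∀ a b, il τ ρ ++ [a] ++ [b] = il (τ ++ [a]) (ρ ++ [b]) := fun a b => by
      rw [il_append h]; simp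
    rw [Nat.mul_succ]
    simp only [sumN, sumN_add, e]
    rw [ih _ _ (by simp [h]), ih _ _ (by simp [h]), ih _ _ (by simp [h]), ih _ _ (by simp [h])]

theorem tsum_strs (S : Set (List Bool)) :
    (∑' σ : S, ((1 : ENNReal) / 2) ^ (σ : List Bool).length) =
      ∑' i : ℕ, (cnt (fun σ => decide (σ ∈ S)) [] i : ENNReal) * (1 / 2) ^ i := by
  rw [tsum_subtype S (fun σ : List Bool => ((1 : ENNReal) / 2) ^ σ.length)]
  rw [← ENNReal.tsum_fiberwise _ List.length]
  congr 1
  funext i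
  have hs : (List.length ⁻¹' {i} : Set (List Bool)) = ((strs i).toFinset : Set (List Bool)) := by
    ext η; simp [mem_strs]
  rw [hs, Finset.tsum_subtype' (strs i).toFinset
    (S.indicator (fun σ : List Bool => ((1 : ENNReal) / 2) ^ σ.length)), cnt, sumN_strs,
    ← List.sum_toFinset _ (strs_nodup i)]
  rw [Nat.cast_sum, Finset.sum_mul]
  refine Finset.sum_congr rfl fun σ hσ => ?_
  have : σ.length = i := mem_strs.1 (by simpa using hσ)
  by_cases h : σ ∈ S <;> simp [h, this]

end Part5

section Part6
set_option linter.unusedSimpArgs false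
set_option linter.unusedSectionVars false

section
variable {α β γ δ : Type} [Primcodable α] [Primcodable β] [Primcodable γ] [Primcodable δ]
variable {O : ℕ → ℕ}

theorem CIn.map1 {f : β → γ} {g : α → β} (hf : Primrec f) (hg : CIn O g) :
    CIn O (fun a => f (g a)) := (CIn.of_primrec hf).comp hg

theorem CIn.map2 {f : β → γ → δ} {g : α → β} {h : α → γ} (hf : Primrec₂ f) (hg : CIn O g)
    (hh : CIn O h) : CIn O (fun a => f (g a) (h a)) :=
  (CIn.of_primrec hf).comp (CIn.pair hg hh)

theorem CIn.and {p q : α → Bool} (hp : CIn O p) (hq : CIn O q) : CIn O (fun a => p a && q a) :=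
  CIn.map2 Primrec.and hp hq
theorem CIn.or {p q : α → Bool} (hp : CIn O p) (hq : CIn O q) : CIn O (fun a => p a || q a) :=
  CIn.map2 Primrec.or hp hq
theorem CIn.not {p : α → Bool} (hp : CIn O p) : CIn O (fun a => ! p a) :=
  CIn.map1 Primrec.not hp
theorem CIn.cond {p : α → Bool} {f g : α → β} (hp : CIn O p) (hf : CIn O f) (hg : CIn O g) :
    CIn O (fun a => bif p a then f a else g a) := by
  have : Primrec (fun x : Bool × β × β => bif x.1 then x.2.1 else x.2.2) :=
    Primrec.cond Primrec.fst (Primrec.fst.comp Primrec.snd) (Primrec.snd.comp Primrec.snd)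
  exact (CIn.of_primrec this).comp (CIn.pair hp (CIn.pair hf hg))

theorem CIn.le {f g : α → ℕ} (hf : CIn O f) (hg : CIn O g) :
    CIn O (fun a => decide (f a ≤ g a)) := by
  obtain ⟨h, hh⟩ := Primrec.nat_le
  refine (CIn.map2 (f := fun a b => decide (a ≤ b)) (hh.of_eq fun x => ?_) hf hg)
  simp
theorem CIn.eqn {f g : α → ℕ} (hf : CIn O f) (hg : CIn O g) :
    CIn O (fun a => decide (f a = g a)) := by
  refine ((hf.le hg).and (hg.le hf)).of_eq fun a => ?_
  rw [← Bool.decide_and, decide_eq_decide]; omega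
theorem CIn.add {f g : α → ℕ} (hf : CIn O f) (hg : CIn O g) : CIn O (fun a => f a + g a) :=
  CIn.map2 Primrec.nat_add hf hg
theorem CIn.mul {f g : α → ℕ} (hf : CIn O f) (hg : CIn O g) : CIn O (fun a => f a * g a) :=
  CIn.map2 Primrec.nat_mul hf hg
theorem pow_primrec (b : ℕ) : Primrec (fun n : ℕ => b ^ n) := by
  refine (Primrec.nat_rec₁ 1 (f := fun _ i => i * b) ?_).of_eq fun n => ?_
  · exact Primrec.nat_mul.comp Primrec.snd (Primrec.const b)
  · induction n with
    | zero => rfl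
    | succ n ih => simp only [ih]; rfl
theorem CIn.pow (b : ℕ) {f : α → ℕ} (hf : CIn O f) : CIn O (fun a => b ^ f a) :=
  CIn.map1 (pow_primrec b) hf
theorem CIn.len {f : α → List β} (hf : CIn O f) : CIn O (fun a => (f a).length) :=
  CIn.map1 Primrec.list_length hf
theorem CIn.append {f g : α → List β} (hf : CIn O f) (hg : CIn O g) : CIn O (fun a => f a ++ g a) :=
  CIn.map2 Primrec.list_append hf hg
theorem CIn.take {f : α → List Bool} {g : α → ℕ} (hf : CIn O f) (hg : CIn O g) :
    CIn O (fun a => (f a).take (g a)) := CIn.map2 list_take_primrec hg hf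

theorem CIn.bex {p : α × β → Bool} {l : α → List β}
    (hl : CIn O l) (hp : CIn O p) : CIn O (fun a => (l a).any (fun b => p (a, b))) := by
  refine (CIn.ball hl hp.not).not.of_eq fun a => ?_
  simp [List.any_eq_not_all_not]

theorem CIn.sum {f : α × List Bool → ℕ} {l : α → List (List Bool)}
    (hl : CIn O l) (hf : CIn O f) : CIn O (fun a => ((l a).map (fun b => f (a, b))).sum) := by
  have hg : CIn O (fun x : α × ℕ × ℕ => x.2.2 + f (x.1, (l x.1).getD x.2.1 [])) := by
    refine CIn.add (CIn.snd.comp CIn.snd) (hf.comp (CIn.pair CIn.fst ?_))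
    exact CIn.map2 (f := fun (l : List (List Bool)) n => l.getD n []) (Primrec.list_getD []) (hl.comp CIn.fst) (CIn.fst.comp CIn.snd)
  refine ((CIn.nat_rec (CIn.const 0) hg).comp (CIn.pair CIn.id hl.len)).of_eq fun a => ?_
  have : ∀ n ≤ (l a).length, (Nat.rec 0 (fun y i => i + f (a, (l a).getD y [])) n : ℕ) =
     (((l a).take n).map (fun b => f (a, b))).sum := by
    intro n
    induction n with
    | zero => intro _; rfl
    | succ n ih =>
      intro h
      simp only [ih (by omega)]
      have h' : n < (l a).length := h
      rw [List.take_add_one, List.map_append, List.sum_append]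
      simp [List.getD, h']
  simpa using this _ le_rfl

theorem strs_primrec : Primrec strs := by
  refine (Primrec.nat_rec₁ [[]] (f := fun _ (i : List (List Bool)) =>
    i.map (false :: ·) ++ i.map (true :: ·)) ?_).of_eq fun n => ?_
  · refine Primrec.list_append.comp (Primrec.list_map Primrec.snd ?_)
      (Primrec.list_map Primrec.snd ?_)
    · exact Primrec.list_cons.comp (Primrec.const false) Primrec.snd
    · exact Primrec.list_cons.comp (Primrec.const true) Primrec.snd
  · induction n with
    | zero => rfl
    | succ n ih => simp only [ih]; rfl

theorem CIn.cnt {P : α × List Bool → Bool} {τ : α → List Bool} {k : α → ℕ} (hP : CIn O P)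
    (hτ : CIn O τ) (hk : CIn O k) : CIn O (fun a => cnt (fun ρ => P (a, ρ)) (τ a) (k a)) := by
  have := CIn.sum (f := fun x => (P (x.1, τ x.1 ++ x.2)).toNat) (CIn.map1 strs_primrec hk) ?_
  · refine this.of_eq fun a => ?_
    rw [_root_.cnt, sumN_strs]
  · have hb : Primrec Bool.toNat := (Primrec.cond Primrec.id (Primrec.const 1)
      (Primrec.const 0)).of_eq fun b => by cases b <;> rfl
    exact CIn.map1 hb (hP.comp (CIn.pair CIn.fst ((hτ.comp CIn.fst).append CIn.snd)))

end

theorem CE_of_CIn {p : ℕ → Bool} (hp : CIn (fun _ => 0) p) : CE {n | p n = true} := by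
  have h1 : CIn (fun _ => 0) (fun n : ℕ => (bif p n.unpair.1 then 0 else 1 : ℕ)) :=
    CIn.cond (CIn.comp hp (CIn.of_primrec (Primrec.fst.comp Primrec.unpair)))
      (CIn.const 0) (CIn.const 1)
  refine ⟨_, RecIn.rfind (CIn.to_TR h1), fun n => ?_⟩
  rw [Set.mem_ofPred_eq]
  refine Iff.trans ?_ (Nat.rfind_dom).symm
  cases h : p n <;> simp [h]

/-! ### Universal test -/
open Nat.Partrec (Code)

noncomputable def UA (e n : ℕ) (ρ : List Bool) : Bool := halts (Denumerable.ofNat Code e) n ρ true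

noncomputable def UD (e n : ℕ) (w : List Bool) : Bool :=
  (List.range (w.length + 1)).any fun t => UA e n (w.take t) &&
    decide (cnt (UA e n) [] t * 2 ^ n ≤ 2 ^ t)

noncomputable def UU (k : ℕ) (w : List Bool) : Bool :=
  (List.range w.length).any fun e => UD e (e + k + 1) w

theorem UA_CIn {O} : CIn O (fun x : ℕ × ℕ × List Bool => UA x.1 x.2.1 x.2.2) :=
  CIn.of_primrec (halts_primrec ((Primrec.ofNat Code).comp Primrec.fst)
    (Primrec.fst.comp Primrec.snd) (Primrec.snd.comp Primrec.snd))

theorem UD_CIn {O} : CIn O (fun x : ℕ × ℕ × List Bool => UD x.1 x.2.1 x.2.2) := by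
  have hw : CIn O (fun x : ℕ × ℕ × List Bool => x.2.2) := CIn.snd.comp CIn.snd
  have h1 : CIn O (fun x : (ℕ × ℕ × List Bool) × ℕ => x.1.1) := CIn.fst.comp CIn.fst
  have h2 : CIn O (fun x : (ℕ × ℕ × List Bool) × ℕ => x.1.2.1) :=
    (CIn.fst.comp CIn.snd).comp CIn.fst
  have h3 : CIn O (fun x : (ℕ × ℕ × List Bool) × ℕ => x.1.2.2) := hw.comp CIn.fst
  have h4 : CIn O (fun x : (ℕ × ℕ × List Bool) × ℕ => UA x.1.1 x.1.2.1 (x.1.2.2.take x.2)) :=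
    UA_CIn.comp (g := fun x : (ℕ × ℕ × List Bool) × ℕ => (x.1.1, x.1.2.1, x.1.2.2.take x.2))
      (CIn.pair h1 (CIn.pair h2 (h3.take CIn.snd)))
  have h5 : CIn O (fun y : ((ℕ × ℕ × List Bool) × ℕ) × List Bool => UA y.1.1.1 y.1.1.2.1 y.2) :=
    UA_CIn.comp (g := fun y : ((ℕ × ℕ × List Bool) × ℕ) × List Bool => (y.1.1.1, y.1.1.2.1, y.2))
      (CIn.pair (h1.comp CIn.fst) (CIn.pair (h2.comp CIn.fst) CIn.snd))
  have h6 : CIn O (fun x : (ℕ × ℕ × List Bool) × ℕ => cnt (UA x.1.1 x.1.2.1) [] x.2) :=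
    CIn.cnt h5 (CIn.const []) CIn.snd
  have h7 := CIn.and h4 (CIn.le (CIn.mul h6 (CIn.pow 2 h2)) (CIn.pow 2 CIn.snd))
  have h8 : CIn O (fun x : ℕ × ℕ × List Bool => List.range (x.2.2.length + 1)) :=
    CIn.map1 Primrec.list_range (hw.len.add (CIn.const 1))
  exact CIn.bex h8 h7

theorem UU_CIn {O} : CIn O (fun x : ℕ × List Bool => UU x.1 x.2) := by
  refine CIn.bex (p := fun x : (ℕ × List Bool) × ℕ => UD x.2 (x.2 + x.1.1 + 1) x.1.2)
    (CIn.map1 Primrec.list_range CIn.snd.len) ?_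
  exact UD_CIn.comp (g := fun x : (ℕ × List Bool) × ℕ => (x.2, x.2 + x.1.1 + 1, x.1.2)) (CIn.pair CIn.snd (CIn.pair ((CIn.snd.add (CIn.fst.comp CIn.fst)).add
    (CIn.const 1)) (CIn.snd.comp CIn.fst)))

theorem UA_mono (e n : ℕ) : Mono (UA e n) := fun _ _ h => halts_mono h (List.prefix_append _ _)

theorem UD_iff {e n w} : UD e n w = true ↔ ∃ t ≤ w.length, UA e n (w.take t) = true ∧
    cnt (UA e n) [] t * 2 ^ n ≤ 2 ^ t := by
  simp [UD]

theorem UD_mono (e n : ℕ) : Mono (UD e n) := by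
  intro ρ b h
  rw [UD_iff] at *
  obtain ⟨t, h1, h2⟩ := h
  refine ⟨t, by simp; omega, ?_⟩
  rwa [List.take_append_of_le_length h1]

theorem UU_iff {k w} : UU k w = true ↔ ∃ e < w.length, UD e (e + k + 1) w = true := by
  simp [UU]

theorem UU_mono (k : ℕ) : Mono (UU k) := by
  intro ρ b h
  rw [UU_iff] at *
  obtain ⟨e, h1, h2⟩ := h
  exact ⟨e, by simp; omega, UD_mono _ _ _ _ h2⟩

theorem UD_cnt (e n m : ℕ) : cnt (UD e n) [] m * 2 ^ n ≤ 2 ^ m := by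
  -- take the largest good t ≤ m
  by_cases hex : ∃ t ≤ m, cnt (UA e n) [] t * 2 ^ n ≤ 2 ^ t
  · obtain ⟨t, ⟨htm, ht⟩, hmax⟩ : ∃ t, (t ≤ m ∧ cnt (UA e n) [] t * 2 ^ n ≤ 2 ^ t) ∧
        ∀ s, s ≤ m → cnt (UA e n) [] s * 2 ^ n ≤ 2 ^ s → s ≤ t := by
      obtain ⟨t0, h0⟩ := hex
      let p := fun t => t ≤ m ∧ cnt (UA e n) [] t * 2 ^ n ≤ 2 ^ t
      refine ⟨Nat.findGreatest p m, Nat.findGreatest_spec (P := p) h0.1 h0, fun s h1 h2 => ?_⟩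
      exact Nat.le_findGreatest h1 ⟨h1, h2⟩
    obtain ⟨d, rfl⟩ := Nat.exists_eq_add_of_le htm
    have : cnt (UD e n) [] (t + d) ≤ cnt (UA e n) [] t * 2 ^ d := by
      rw [cnt_split, mul_comm, cnt, ← sumN_mul]
      refine sumN_le fun η hη => ?_
      simp only [List.nil_append]
      cases hA : UA e n η with
      | true => simpa using cnt_le _ _ _
      | false =>
        rw [cnt_none]; · simp
        intro η' hη'
        by_contra hD
        obtain ⟨s, hs, h1, h2⟩ := UD_iff.1 (by simpa using hD : UD e n (η ++ η') = true)
        have hst := hmax s (by simpa [hη, hη'] using hs) h2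
        rw [List.take_append_of_le_length (by omega)] at h1
        have := (UA_mono e n).append h1 (η.drop s)
        rw [List.take_append_drop, hA] at this
        exact absurd this (by simp)
    calc _ ≤ cnt (UA e n) [] t * 2 ^ d * 2 ^ n := Nat.mul_le_mul_right _ this
      _ = cnt (UA e n) [] t * 2 ^ n * 2 ^ d := by ring
      _ ≤ 2 ^ t * 2 ^ d := Nat.mul_le_mul_right _ ht
      _ = _ := by rw [pow_add]
  · rw [cnt_none]; · simp
    intro η hη
    by_contra hD
    obtain ⟨s, hs, h1, h2⟩ := UD_iff.1 (by simpa using hD : UD e n ([] ++ η) = true)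
    exact hex ⟨s, by simpa [hη] using hs, h2⟩

theorem UU_cnt (k m : ℕ) : cnt (UU k) [] m * 2 ^ k ≤ 2 ^ m := by
  have key : ∀ N, cnt (fun w => (List.range N).any fun e => UD e (e + k + 1) w) [] m * 2 ^ (k + N)
      + 2 ^ m ≤ 2 ^ m * 2 ^ N := by
    intro N
    induction N with
    | zero => rw [cnt_none] <;> simp
    | succ N ih =>
      have h1 := cnt_or (P := fun w => (List.range (N + 1)).any fun e => UD e (e + k + 1) w)
        (Q := fun w => (List.range N).any fun e => UD e (e + k + 1) w)
        (R := UD N (N + k + 1)) (τ := []) (k := m) (by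
          intro η _ h
          rw [List.range_succ, List.any_append] at h
          simpa using h)
      have h2 := UD_cnt N (N + k + 1) m
      have h3 : (2:ℕ) ^ (k + (N + 1)) = 2 ^ (k + N) * 2 := by rw [← pow_succ]; rfl
      have h4 : (2:ℕ) ^ (N + k + 1) = 2 ^ (k + N) * 2 := by rw [← pow_succ]; ring_nf
      rw [h4] at h2
      rw [h3, pow_succ]
      generalize 2 ^ (k + N) = X at *
      generalize 2 ^ m = Y at *
      generalize 2 ^ N = Z at *
      nlinarith [Nat.mul_le_mul_right (X * 2) h1]
  have h := key m
  have e : cnt (UU k) [] m ≤ cnt (fun w => (List.range m).any fun e => UD e (e + k + 1) w) [] m := by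
    refine cnt_mono fun η hη h => ?_
    simpa [UU, hη] using h
  have h5 : cnt (UU k) [] m * 2 ^ k * 2 ^ m ≤ 2 ^ m * 2 ^ m := by
    calc _ = cnt (UU k) [] m * 2 ^ (k + m) := by rw [pow_add]; ring
      _ ≤ _ := Nat.mul_le_mul_right _ e
      _ ≤ _ := le_trans (Nat.le_add_right _ _) h
  exact Nat.le_of_mul_le_mul_right h5 (by positivity)

end Part6

section Part7
set_option linter.unusedSimpArgs false
open Nat.Partrec (Code)

theorem tsum_le_iff (S : Set (List Bool)) (n : ℕ) :
    (∑' σ : S, ((1 : ENNReal) / 2) ^ (σ : List Bool).length) ≤ (1 / 2) ^ n ↔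
      ∀ t, (∑ i ∈ Finset.range t, (cnt (fun σ => decide (σ ∈ S)) [] i : ℝ) * (1 / 2) ^ i)
        ≤ (1 / 2) ^ n := by
  rw [tsum_strs]
  have half : (1 / 2 : ENNReal) = ((1 / 2 : NNReal) : ENNReal) := by
    rw [ENNReal.coe_div (by norm_num)]; simp
  have key : ∀ t, (∑ i ∈ Finset.range t,
      (cnt (fun σ => decide (σ ∈ S)) [] i : ENNReal) * (1 / 2) ^ i) ≤ (1 / 2) ^ n ↔
      (∑ i ∈ Finset.range t, (cnt (fun σ => decide (σ ∈ S)) [] i : ℝ) * (1 / 2) ^ i)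
        ≤ (1 / 2) ^ n := by
    intro t
    rw [half]
    have h1 : (∑ i ∈ Finset.range t, (cnt (fun σ => decide (σ ∈ S)) [] i : ENNReal) *
        ((1 / 2 : NNReal) : ENNReal) ^ i) = ((∑ i ∈ Finset.range t,
          (cnt (fun σ => decide (σ ∈ S)) [] i : NNReal) * (1 / 2) ^ i : NNReal) : ENNReal) := by
      push_cast; rfl
    rw [h1, ← ENNReal.coe_pow, ENNReal.coe_le_coe, ← NNReal.coe_le_coe]
    push_cast
    rfl
  constructor
  · intro h t
    exact (key t).1 ((ENNReal.sum_le_tsum _).trans h)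
  · intro h
    exact ENNReal.tsum_le_of_sum_range_le fun t => (key t).2 (h t)

theorem take_cnt (S : Set (List Bool)) (t : ℕ) :
    (cnt (fun ρ => decide (∃ j ≤ ρ.length, ρ.take j ∈ S)) [] t : ℝ) * (1 / 2) ^ t ≤
      ∑ i ∈ Finset.range (t + 1), (cnt (fun σ => decide (σ ∈ S)) [] i : ℝ) * (1 / 2) ^ i := by
  induction t with
  | zero => simp [cnt, sumN]
  | succ t ih =>
    rw [Finset.sum_range_succ]
    set E : List Bool → Bool := fun ρ => decide (∃ j ≤ ρ.length, ρ.take j ∈ S) with hE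
    have h : cnt E [] (t + 1) ≤ 2 * cnt E [] t + cnt (fun σ => decide (σ ∈ S)) [] (t + 1) := by
      have h1 := cnt_or (P := E) (Q := fun ρ => E (ρ.take t)) (R := fun σ => decide (σ ∈ S))
        (τ := []) (k := t + 1) (by
          intro η hη h
          simp only [hE, List.nil_append, decide_eq_true_eq] at h ⊢
          obtain ⟨j, hj, h⟩ := h
          rcases Nat.lt_or_ge t j with hj' | hj'
          · right
            rwa [List.take_of_length_le (by omega)] at h
          · left
            refine ⟨j, by simp; omega, ?_⟩
            rwa [List.take_take, Nat.min_eq_left hj'])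
      refine h1.trans (Nat.add_le_add_right ?_ _)
      rw [cnt_split, mul_comm, mul_comm, cnt, ← sumN_mul]
      refine sumN_le fun η hη => ?_
      simp [cnt, sumN, hη, List.take_append]
      omega
    have h' : (cnt E [] (t + 1) : ℝ) ≤
        2 * cnt E [] t + cnt (fun σ => decide (σ ∈ S)) [] (t + 1) := by exact_mod_cast h
    have hp : (0:ℝ) ≤ (1/2)^(t+1) := by positivity
    have e : ((1:ℝ)/2)^t = 2 * (1/2)^(t+1) := by rw [pow_succ]; ring
    rw [e] at ih
    nlinarith [mul_le_mul_of_nonneg_right h' hp]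

theorem nat_of_half {x t n : ℕ} (h : (x : ℝ) * (1 / 2) ^ t ≤ (1 / 2) ^ n) : x * 2 ^ n ≤ 2 ^ t := by
  have : (x : ℝ) * 2 ^ n ≤ 2 ^ t := by
    rw [one_div, inv_pow, inv_pow] at h
    have h2 : (0:ℝ) < 2 ^ t := by positivity
    have h3 : (0:ℝ) < 2 ^ n := by positivity
    rw [← div_eq_mul_inv, div_le_iff₀ h2, inv_mul_eq_div, le_div_iff₀ h3] at h
    exact h
  exact_mod_cast this

theorem half_of_nat {x t n : ℕ} (h : x * 2 ^ n ≤ 2 ^ t) : (x : ℝ) * (1 / 2) ^ t ≤ (1 / 2) ^ n := by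
  have h : (x : ℝ) * 2 ^ n ≤ 2 ^ t := by exact_mod_cast h
  rw [one_div, inv_pow, inv_pow]
  have h2 : (0:ℝ) < 2 ^ t := by positivity
  have h3 : (0:ℝ) < 2 ^ n := by positivity
  rw [← div_eq_mul_inv, div_le_iff₀ h2, inv_mul_eq_div, le_div_iff₀ h3]
  exact h

theorem random_of_UU {A : Set ℕ} {k : ℕ} (h : ∀ n, UU k (seg A n) = false) : MLRandom A := by
  intro V ⟨⟨g, hg, hgV⟩, hV⟩
  obtain ⟨c, hc⟩ := Code.exists_code.1 hg.to_partrec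
  have hmem : ∀ n σ, σ ∈ V n ↔ (c.eval (Nat.pair n (Encodable.encode σ))).Dom := by
    intro n σ
    rw [hc, ← hgV, Set.mem_ofPred_eq]
    simp
  set e := Encodable.encode c with he
  by_contra hcon
  push Not at hcon
  obtain ⟨m, hm⟩ := hcon (e + k + 1)
  obtain ⟨x, hx⟩ := Part.dom_iff_mem.1 ((hmem _ _).1 hm)
  obtain ⟨k0, hk⟩ := evaln_isSome_of_mem hx
  have hA : UA e (e + k + 1) (seg A (max m k0)) = true := by
    rw [UA, halts_iff]
    refine ⟨m, by simp, ?_⟩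
    rw [seg_take A (le_max_left _ _), he, Denumerable.ofNat_encode]
    exact hk _ (by simp)
  set t := max m k0
  have hcount : cnt (UA e (e + k + 1)) [] t * 2 ^ (e + k + 1) ≤ 2 ^ t := by
    refine le_trans (Nat.mul_le_mul_right _ (cnt_mono
      (Q := fun ρ => decide (∃ j ≤ ρ.length, ρ.take j ∈ V (e + k + 1))) ?_)) (nat_of_half ((take_cnt
        (V (e + k + 1)) t).trans ((tsum_le_iff _ _).1 (hV _) _)))
    intro η _ h
    rw [UA, halts_iff] at h
    obtain ⟨j, hj, h⟩ := h
    rw [decide_eq_true_eq]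
    refine ⟨j, hj, (hmem _ _).2 ?_⟩
    obtain ⟨x, hx⟩ := Option.isSome_iff_exists.1 h
    rw [he, Denumerable.ofNat_encode] at hx
    exact Part.dom_iff_mem.2 ⟨x, Code.evaln_sound hx⟩
  have : UU k (seg A (max t (e + 1))) = true := by
    rw [UU_iff]
    refine ⟨e, by simp, ?_⟩
    rw [UD_iff]
    refine ⟨t, by simp, ?_, hcount⟩
    rwa [seg_take A (le_max_left _ _)]
  rw [h] at this
  exact absurd this (by simp)

/-! ### Lemma R (van Lambalgen style) -/

noncomputable def RD (k m : ℕ) (τ : List Bool) : Bool :=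
  ! decide (2 ^ m * cnt (fun ρ => UU k (il τ ρ)) [] τ.length ≤ 2 ^ τ.length)

theorem RD_CIn {O} : CIn O (fun x : ℕ × ℕ × List Bool => RD x.1 x.2.1 x.2.2) := by
  have hτ : CIn O (fun x : ℕ × ℕ × List Bool => x.2.2) := CIn.snd.comp CIn.snd
  have hm : CIn O (fun x : ℕ × ℕ × List Bool => x.2.1) := CIn.fst.comp CIn.snd
  have h1 : CIn O (fun y : (ℕ × ℕ × List Bool) × List Bool => UU y.1.1 (il y.1.2.2 y.2)) :=
    UU_CIn.comp (g := fun y : (ℕ × ℕ × List Bool) × List Bool => (y.1.1, il y.1.2.2 y.2))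
      (CIn.pair (CIn.fst.comp CIn.fst) (CIn.map2 il_primrec (hτ.comp CIn.fst) CIn.snd))
  have h2 : CIn O (fun x : ℕ × ℕ × List Bool =>
      cnt (fun ρ => UU x.1 (il x.2.2 ρ)) [] x.2.2.length) := CIn.cnt h1 (CIn.const []) hτ.len
  exact (CIn.le (CIn.mul (CIn.pow 2 hm) h2) (CIn.pow 2 hτ.len)).not

theorem RD_nil (k m : ℕ) : RD k m [] = false := by
  simp [RD, cnt, sumN, il, UU]

theorem cnt_il_succ {P : List Bool → Bool} (hP : Mono P) (τ : List Bool) (a : Bool) :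
    2 * cnt (fun ρ => P (il τ ρ)) [] τ.length ≤
      cnt (fun ρ => P (il (τ ++ [a]) ρ)) [] (τ.length + 1) := by
  rw [cnt_split, cnt, ← sumN_mul]
  refine sumN_le fun η hη => ?_
  simp only [cnt, sumN, List.nil_append, il_append hη.symm]
  cases h : P (il τ η)
  · simp
  · simp [hP.append h]

theorem RD_mono (k m : ℕ) : Mono (RD k m) := by
  intro τ a h
  simp only [RD, Bool.not_eq_true', decide_eq_false_iff_not, not_le] at h ⊢
  have := cnt_il_succ (UU_mono k) τ a
  rw [List.length_append, List.length_singleton, pow_succ]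
  nlinarith [Nat.mul_le_mul_left (2 ^ m) this]

theorem RD_cnt (m t : ℕ) : cnt (RD (2 * m) m) [] t * 2 ^ m ≤ 2 ^ t := by
  have h1 : 2 ^ t * cnt (RD (2 * m) m) [] t ≤ 2 ^ m * cnt (UU (2 * m)) [] (2 * t) := by
    have := sumN_il (fun ρ => (UU (2 * m) ρ).toNat) t [] [] rfl
    rw [cnt, cnt, show ([] : List Bool) = il [] [] from rfl, ← this, ← sumN_mul, ← sumN_mul]
    refine sumN_le fun η hη => ?_
    have hη' : (il [] [] ++ η).length = t := by simpa [il] using hη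
    cases h : RD (2 * m) m (il [] [] ++ η)
    · simp
    · simp only [RD, Bool.not_eq_true', decide_eq_false_iff_not, not_le, hη'] at h
      simpa [cnt] using h.le
  have h2 := UU_cnt (2 * m) (2 * t)
  have e1 : (2:ℕ) ^ (2 * m) = 2 ^ m * 2 ^ m := by rw [two_mul, pow_add]
  have e2 : (2:ℕ) ^ (2 * t) = 2 ^ t * 2 ^ t := by rw [two_mul, pow_add]
  rw [e1, e2] at h2
  have hx : (0:ℕ) < 2 ^ m := by positivity
  have hy : (0:ℕ) < 2 ^ t := by positivity
  generalize (2:ℕ) ^ m = X at *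
  generalize (2:ℕ) ^ t = Y at *
  have h3 : (cnt (RD (2 * m) m) [] t * X) * Y ≤ Y * Y := by
    nlinarith [Nat.mul_le_mul_right X h1]
  exact Nat.le_of_mul_le_mul_right h3 hy

theorem lemmaR {L : Set ℕ} (hL : MLRandom L) (c : ℕ) :
    ∃ k, ∀ t, 2 ^ c * cnt (fun ρ => UU k (il (seg L t) ρ)) [] t ≤ 2 ^ t := by
  let D : ℕ → List Bool → Bool := fun n => RD (2 * (n + c)) (n + c)
  let T : ℕ → List Bool → Bool := fun n τ => D n τ && ! D n τ.dropLast
  have htest : MLTest (fun n => {τ | T n τ = true}) := by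
    constructor
    · have hD : CIn (fun _ => 0) (fun x : ℕ × List Bool => D x.1 x.2) :=
        RD_CIn.comp (g := fun x : ℕ × List Bool => (2 * (x.1 + c), x.1 + c, x.2))
          (CIn.pair (CIn.mul (CIn.const 2) (CIn.fst.add (CIn.const c)))
            (CIn.pair (CIn.fst.add (CIn.const c)) CIn.snd))
      have hdl : Primrec (fun l : List Bool => l.dropLast) :=
        (list_take_primrec.comp (Primrec.nat_sub.comp Primrec.list_length (Primrec.const 1))
          Primrec.id).of_eq fun l => by simp [List.dropLast_eq_take]
      have hT : CIn (fun _ => 0) (fun x : ℕ × List Bool => T x.1 x.2) :=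
        hD.and (hD.comp (g := fun x : ℕ × List Bool => (x.1, x.2.dropLast))
          (CIn.pair CIn.fst (CIn.map1 hdl CIn.snd))).not
      have hσ : CIn (fun _ => 0) (fun p : ℕ =>
          ((Encodable.decode p.unpair.2 : Option (List Bool)).getD [])) :=
        CIn.of_primrec (Primrec.option_getD.comp
          (Primrec.decode.comp (Primrec.snd.comp Primrec.unpair)) (Primrec.const []))
      have hp : CIn (fun _ => 0) (fun p : ℕ =>
          T p.unpair.1 ((Encodable.decode p.unpair.2 : Option (List Bool)).getD []) &&
          decide (p.unpair.2 =
            Encodable.encode ((Encodable.decode p.unpair.2 : Option (List Bool)).getD []))) := by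
        refine CIn.and (hT.comp (g := fun p : ℕ => (p.unpair.1,
          ((Encodable.decode p.unpair.2 : Option (List Bool)).getD [])))
          (CIn.pair (CIn.of_primrec (Primrec.fst.comp Primrec.unpair)) hσ)) ?_
        exact CIn.eqn (CIn.of_primrec (Primrec.snd.comp Primrec.unpair))
          (CIn.map1 Primrec.encode hσ)
      convert CE_of_CIn hp using 1
      ext p
      simp only [Set.mem_ofPred_eq, Bool.and_eq_true, decide_eq_true_eq]
      constructor
      · rintro ⟨σ, h1, h2⟩
        simp only [h2, Encodable.encodek, Option.getD_some]
        exact ⟨h1, trivial⟩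
      · rintro ⟨h1, h2⟩
        exact ⟨_, h1, h2⟩
    · intro n
      rw [tsum_le_iff]
      have heq : ∀ t, (∑ i ∈ Finset.range (t + 1), (cnt (T n) [] i : ℝ) * (1 / 2) ^ i)
          = cnt (D n) [] t * (1 / 2) ^ t := by
        intro t
        induction t with
        | zero => simp [cnt, sumN, T, D, RD_nil]
        | succ t ih =>
          rw [Finset.sum_range_succ, ih]
          have : cnt (D n) [] (t + 1) = 2 * cnt (D n) [] t + cnt (T n) [] (t + 1) := by
            rw [cnt_split, cnt_split (T n), cnt, ← sumN_mul, ← sumN_add]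
            refine sumN_congr fun η _ => ?_
            have h1 := RD_mono (2 * (n + c)) (n + c) η false
            have h2 := RD_mono (2 * (n + c)) (n + c) η true
            simp only [cnt, sumN, T, D, List.nil_append, List.dropLast_concat]
            cases h : RD (2 * (n + c)) (n + c) η
            · simp
            · simp [h1 h, h2 h]
          rw [this, pow_succ]; push_cast; ring
      intro t
      have h1 : (∑ i ∈ Finset.range t, (cnt (T n) [] i : ℝ) * (1 / 2) ^ i) ≤ 
          (∑ i ∈ Finset.range (t + 1), (cnt (T n) [] i : ℝ) * (1 / 2) ^ i) := by
        rw [Finset.sum_range_succ]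
        have : (0:ℝ) ≤ (cnt (T n) [] t : ℝ) * (1 / 2) ^ t := by positivity
        linarith
      have h2 : (cnt (D n) [] t : ℝ) * (1 / 2) ^ t ≤ (1 / 2) ^ n := by
        refine half_of_nat (le_trans (Nat.mul_le_mul_left _ ?_) (RD_cnt (n + c) t))
        exact Nat.pow_le_pow_right (by norm_num) (by omega)
      rw [heq] at h1
      simpa using h1.trans h2
  obtain ⟨n, hn⟩ := hL _ htest
  refine ⟨2 * (n + c), fun t => ?_⟩
  have hD : ∀ t, D n (seg L t) = false := by
    intro t
    induction t with
    | zero => exact RD_nil _ _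
    | succ t ih =>
      by_contra h
      apply hn (t + 1)
      have : (seg L (t + 1)).dropLast = seg L t := by rw [seg_succ]; simp
      simp only [Set.mem_ofPred_eq, T, this, ih]
      simpa using h
  have := hD t
  simp only [D, RD, Bool.not_eq_false', decide_eq_true_eq, seg_length] at this
  refine le_trans (Nat.mul_le_mul_right _ ?_) this
  exact Nat.pow_le_pow_right (by norm_num) (by omega)

end Part7

section Part8
set_option linter.unusedSimpArgs false

abbrev St : Type := List (ℕ × ℕ) × List Bool × ℕ × ℕ
abbrev Yo : Type := Bool × List Bool × Bool

noncomputable def IL (L : Set ℕ) (ρ : List Bool) : List Bool := il (seg L ρ.length) ρ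

theorem IL_succ (L : Set ℕ) (ρ : List Bool) (b : Bool) :
    IL L (ρ ++ [b]) = IL L ρ ++ [decide (ρ.length ∈ L), b] := by
  rw [IL, List.length_append, List.length_singleton, seg_succ, il_append (by simp)]; rfl

theorem IL_prefix (L : Set ℕ) (ρ η : List Bool) : IL L ρ <+: IL L (ρ ++ η) := by
  induction η generalizing ρ with
  | nil => simp
  | cons b η ih =>
    have := ih (ρ ++ [b])
    rw [IL_succ] at this
    simpa using (List.prefix_append _ _).trans this

theorem IL_CIn (L : Set ℕ) : CIn (chi L) (IL L) :=
  CIn.map2 (f := il) il_primrec ((seg_CIn L).comp (CIn.id (α := List Bool)).len) CIn.id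

noncomputable def PP (L : Set ℕ) (k0 : ℕ) (ℓ : List (ℕ × ℕ)) (ρ : List Bool) : Bool :=
  UU k0 (IL L ρ) || ℓ.any (fun q => G q.1 (IL L ρ) && ! G q.1 (IL L (ρ.take q.2)))

theorem PP_CIn (L : Set ℕ) (k0 : ℕ) :
    CIn (chi L) (fun x : List (ℕ × ℕ) × List Bool => PP L k0 x.1 x.2) := by
  have hIL : CIn (chi L) (fun x : List (ℕ × ℕ) × List Bool => IL L x.2) := (IL_CIn L).comp CIn.snd
  have h1 : CIn (chi L) (fun x : List (ℕ × ℕ) × List Bool => UU k0 (IL L x.2)) :=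
    UU_CIn.comp (CIn.pair (CIn.const k0) hIL)
  have hi : CIn (chi L) (fun x : (List (ℕ × ℕ) × List Bool) × (ℕ × ℕ) => x.2.1) :=
    CIn.fst.comp CIn.snd
  have hs : CIn (chi L) (fun x : (List (ℕ × ℕ) × List Bool) × (ℕ × ℕ) => x.2.2) :=
    CIn.snd.comp CIn.snd
  have hρ : CIn (chi L) (fun x : (List (ℕ × ℕ) × List Bool) × (ℕ × ℕ) => x.1.2) :=
    CIn.snd.comp CIn.fst
  have h2 : CIn (chi L) (fun x : (List (ℕ × ℕ) × List Bool) × (ℕ × ℕ) =>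
    G x.2.1 (IL L x.1.2)) := CIn.map2 G_primrec hi ((IL_CIn L).comp hρ)
  have h3 : CIn (chi L) (fun x : (List (ℕ × ℕ) × List Bool) × (ℕ × ℕ) =>
    G x.2.1 (IL L (x.1.2.take x.2.2))) := CIn.map2 G_primrec hi ((IL_CIn L).comp (hρ.take hs))
  exact h1.or (CIn.bex CIn.fst (h2.and h3.not))

theorem PP_iff {L k0 ℓ ρ} : PP L k0 ℓ ρ = true ↔ UU k0 (IL L ρ) = true ∨
    ∃ q ∈ ℓ, G q.1 (IL L ρ) = true ∧ G q.1 (IL L (ρ.take q.2)) = false := by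
  simp [PP]

theorem PP_mono (L : Set ℕ) (k0 : ℕ) (ℓ : List (ℕ × ℕ)) : Mono (PP L k0 ℓ) := by
  intro ρ b h
  rw [PP_iff] at *
  rcases h with h | ⟨q, hq, h1, h2⟩
  · left
    rw [IL_succ]
    exact (UU_mono k0).append h _
  · right
    refine ⟨q, hq, G_mono h1 (IL_prefix _ _ _), ?_⟩
    rcases Nat.lt_or_ge ρ.length q.2 with h | h
    · rw [List.take_of_length_le h.le, h1] at h2
      exact absurd h2 (by simp)
    · rwa [List.take_append_of_le_length h]

theorem PP_subset {L k0 ℓ ℓ' ρ} (hs : ∀ q ∈ ℓ, q ∈ ℓ') (h : PP L k0 ℓ ρ = true) :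
    PP L k0 ℓ' ρ = true := by
  rw [PP_iff] at *
  rcases h with h | ⟨q, hq, h⟩
  · exact Or.inl h
  · exact Or.inr ⟨q, hs q hq, h⟩

def OK (L : Set ℕ) (M : List Bool → ℚ) (C k0 : ℕ) (x : St) : Prop :=
  ∀ k, 4 ^ x.2.2.2 * (M x.2.1 * 2 ^ k + C * (cnt (PP L k0 x.1) x.2.1 k : ℚ)) ≤ x.2.2.1 * 2 ^ k

theorem M_CIn {M : List Bool → ℚ} (hM : FRed M K) (h0 : ∀ σ, 0 ≤ M σ) :
    CIn (chi K) (fun τ => ((M τ).num.natAbs, (M τ).den)) := by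
  have h : TR (chi K) (fnOracle M) := hM
  have hp : Primrec (fun v : ℕ => (Nat.casesOn v 0
      (fun w => Nat.succ (Nat.pair (w.unpair.1 / 2) w.unpair.2)) : ℕ)) := by
    refine Primrec.nat_casesOn Primrec.id (Primrec.const 0) ?_
    have hw : Primrec (fun x : ℕ × ℕ => x.2.unpair) := Primrec.unpair.comp Primrec.snd
    exact Primrec.succ.comp (Primrec₂.natPair.comp (Primrec.nat_div.comp (Primrec.fst.comp hw)
      (Primrec.const 2)) (Primrec.snd.comp hw))
  refine ((TR.of_computable hp.to_comp).comp h).of_eq fun n => ?_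
  simp only [fnOracle]
  cases hd : (Encodable.decode n : Option (List Bool)) with
  | none => 
    have hd' : (@Encodable.decode (List Bool) List.encodable n) = none := hd
    simp [hd, hd']
  | some τ =>
    have hd' : (@Encodable.decode (List Bool) List.encodable n) = some τ := hd
    simp only [hd', Option.map_some, Encodable.encode_some]
    have e1 : Encodable.encode (M τ) = Nat.pair (Encodable.encode (M τ).num) (M τ).den := rfl
    rw [e1]
    have hnn : 0 ≤ (M τ).num := Rat.num_nonneg.2 (h0 τ)
    have e2 : Encodable.encode (M τ).num = 2 * (M τ).num.natAbs := by
      obtain ⟨N, hN⟩ := Int.eq_ofNat_of_zero_le hnn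
      rw [hN]; rfl
    rw [e2]
    simp

theorem OK_arith {m N d E k C c a : ℚ} (h : m = N / d) (hd : 0 < d) :
    E * (m * k + C * c) ≤ a * k ↔ E * (N * k + C * c * d) ≤ a * k * d := by
  rw [← mul_le_mul_iff_left₀ hd, h]
  have : E * (N / d * k + C * c) * d = E * (N * k + C * c * d) := by field_simp
  rw [this]

theorem OK_CIn {L : Set ℕ} (hL : Low L) {M : List Bool → ℚ} (hM : FRed M K) (h0 : ∀ σ, 0 ≤ M σ)
    (C k0 : ℕ) : CIn (chi K) (fun x : St => decide (OK L M C k0 x)) := by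
  have hx : CIn (chi L) (fun y : (St × (ℕ × ℕ)) × ℕ => y.1.1) := CIn.fst.comp CIn.fst
  have hℓ : CIn (chi L) (fun y : (St × (ℕ × ℕ)) × ℕ => y.1.1.1) := CIn.fst.comp hx
  have hx2 : CIn (chi L) (fun y : (St × (ℕ × ℕ)) × ℕ => y.1.1.2) := CIn.snd.comp hx
  have hτ : CIn (chi L) (fun y : (St × (ℕ × ℕ)) × ℕ => y.1.1.2.1) := CIn.fst.comp hx2
  have hx3 : CIn (chi L) (fun y : (St × (ℕ × ℕ)) × ℕ => y.1.1.2.2) := CIn.snd.comp hx2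
  have ha : CIn (chi L) (fun y : (St × (ℕ × ℕ)) × ℕ => y.1.1.2.2.1) := CIn.fst.comp hx3
  have he : CIn (chi L) (fun y : (St × (ℕ × ℕ)) × ℕ => y.1.1.2.2.2) := CIn.snd.comp hx3
  have hn : CIn (chi L) (fun y : (St × (ℕ × ℕ)) × ℕ => y.1.2) := CIn.snd.comp CIn.fst
  have hN : CIn (chi L) (fun y : (St × (ℕ × ℕ)) × ℕ => y.1.2.1) := CIn.fst.comp hn
  have hd : CIn (chi L) (fun y : (St × (ℕ × ℕ)) × ℕ => y.1.2.2) := CIn.snd.comp hn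
  have hk : CIn (chi L) (fun y : (St × (ℕ × ℕ)) × ℕ => y.2) := CIn.snd
  have hP : CIn (chi L) (fun z : ((St × (ℕ × ℕ)) × ℕ) × List Bool => PP L k0 z.1.1.1.1 z.2) :=
    (PP_CIn L k0).comp (g := fun z : ((St × (ℕ × ℕ)) × ℕ) × List Bool => (z.1.1.1.1, z.2))
      (CIn.pair (hℓ.comp CIn.fst) CIn.snd)
  have hc : CIn (chi L) (fun y : (St × (ℕ × ℕ)) × ℕ => cnt (PP L k0 y.1.1.1) y.1.1.2.1 y.2) :=
    CIn.cnt hP hτ hk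
  have h1 := CIn.not (CIn.le (CIn.mul (CIn.pow 4 he) (CIn.add (CIn.mul hN (CIn.pow 2 hk))
    (CIn.mul (CIn.mul (CIn.const C) hc) hd))) (CIn.mul (CIn.mul ha (CIn.pow 2 hk)) hd))
  have h2 := (low_decide hL h1).not
  have h3 := h2.comp (CIn.pair (CIn.id (α := St)) ((M_CIn hM h0).comp (CIn.fst.comp CIn.snd)))
  refine h3.of_eq fun x => ?_
  rw [← decide_not, decide_eq_decide, not_exists]
  unfold OK
  refine forall_congr' fun k => ?_
  simp only [Bool.not_eq_true', decide_eq_false_iff_not, not_not]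
  have hnn : 0 ≤ (M x.2.1).num := Rat.num_nonneg.2 (h0 _)
  have hMe : M x.2.1 = ((M x.2.1).num.natAbs : ℚ) / (M x.2.1).den := by
    conv_lhs => rw [← Rat.num_div_den (M x.2.1)]
    congr 1
    rw [← Int.cast_natCast, Int.natAbs_of_nonneg hnn]
  have hden : (0:ℚ) < (M x.2.1).den := by exact_mod_cast (M x.2.1).den_pos
  rw [← Nat.cast_le (α := ℚ)]
  push_cast
  exact (OK_arith hMe hden).symm

section
variable (L : Set ℕ) (M : List Bool → ℚ) (C k0 : ℕ)

noncomputable def good (st : St) (η : List Bool) : Bool :=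
  G st.2.2.2 (IL L (st.2.1 ++ η)) && (List.range (η.length + 1)).all fun j =>
    decide (OK L M C k0 (st.1, st.2.1 ++ η.take j, 4 * st.2.2.1 + 2, st.2.2.2 + 1))

def next (st : St) (y : Yo) : St :=
  bif y.1 then (st.1, st.2.1 ++ y.2.1 ++ [y.2.2], 4 * st.2.2.1 + 2, st.2.2.2 + 1)
  else ((st.2.2.2, st.2.1.length + y.2.1.length) :: st.1, st.2.1 ++ [y.2.2],
    4 * st.2.2.1 + 1, st.2.2.2 + 1)

noncomputable def valid (st : St) (y : Yo) : Bool :=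
  (bif y.1 then good L M C k0 st y.2.1
    else (strs y.2.1.length).all fun η => ! good L M C k0 st η) &&
  decide (OK L M C k0 (next st y))
end

theorem next_CIn {O} : CIn O (fun x : St × Yo => next x.1 x.2) := by
  have hst : CIn O (fun x : St × Yo => x.1) := CIn.fst
  have hℓ : CIn O (fun x : St × Yo => x.1.1) := CIn.fst.comp hst
  have h2 : CIn O (fun x : St × Yo => x.1.2) := CIn.snd.comp hst
  have hσ : CIn O (fun x : St × Yo => x.1.2.1) := CIn.fst.comp h2
  have h3 : CIn O (fun x : St × Yo => x.1.2.2) := CIn.snd.comp h2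
  have ha : CIn O (fun x : St × Yo => x.1.2.2.1) := CIn.fst.comp h3
  have he : CIn O (fun x : St × Yo => x.1.2.2.2) := CIn.snd.comp h3
  have hy : CIn O (fun x : St × Yo => x.2) := CIn.snd
  have hf : CIn O (fun x : St × Yo => x.2.1) := CIn.fst.comp hy
  have hy2 : CIn O (fun x : St × Yo => x.2.2) := CIn.snd.comp hy
  have hη : CIn O (fun x : St × Yo => x.2.2.1) := CIn.fst.comp hy2
  have hb : CIn O (fun x : St × Yo => x.2.2.2) := CIn.snd.comp hy2
  have hbl : CIn O (fun x : St × Yo => [x.2.2.2]) :=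
    CIn.map2 Primrec.list_cons hb (CIn.const [])
  have h4a := CIn.mul (CIn.const 4) ha
  have he1 := he.add (CIn.const 1)
  refine CIn.cond hf ?_ ?_
  · exact CIn.pair hℓ (CIn.pair ((hσ.append hη).append hbl) (CIn.pair (h4a.add (CIn.const 2)) he1))
  · exact CIn.pair (CIn.map2 Primrec.list_cons (CIn.pair he (hσ.len.add hη.len)) hℓ)
      (CIn.pair (hσ.append hbl) (CIn.pair (h4a.add (CIn.const 1)) he1))

theorem good_CIn {L : Set ℕ} (hL : Low L) {M : List Bool → ℚ} (hM : FRed M K) (h0 : ∀ σ, 0 ≤ M σ)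
    (C k0 : ℕ) : CIn (chi K) (fun x : St × List Bool => good L M C k0 x.1 x.2) := by
  have hG0 : CIn (chi L) (fun x : St × List Bool => G x.1.2.2.2 (IL L (x.1.2.1 ++ x.2))) := by
    have hst : CIn (chi L) (fun x : St × List Bool => x.1) := CIn.fst
    have h2 : CIn (chi L) (fun x : St × List Bool => x.1.2) := CIn.snd.comp hst
    have hσ : CIn (chi L) (fun x : St × List Bool => x.1.2.1) := CIn.fst.comp h2
    have h3 : CIn (chi L) (fun x : St × List Bool => x.1.2.2) := CIn.snd.comp h2
    have he : CIn (chi L) (fun x : St × List Bool => x.1.2.2.2) := CIn.snd.comp h3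
    exact CIn.map2 G_primrec he ((IL_CIn L).comp (hσ.append CIn.snd))
  have hG := low_decide' hL hG0
  have hst : CIn (chi K) (fun x : (St × List Bool) × ℕ => x.1.1) := CIn.fst.comp CIn.fst
  have hℓ : CIn (chi K) (fun x : (St × List Bool) × ℕ => x.1.1.1) := CIn.fst.comp hst
  have h2 : CIn (chi K) (fun x : (St × List Bool) × ℕ => x.1.1.2) := CIn.snd.comp hst
  have hσ : CIn (chi K) (fun x : (St × List Bool) × ℕ => x.1.1.2.1) := CIn.fst.comp h2
  have h3 : CIn (chi K) (fun x : (St × List Bool) × ℕ => x.1.1.2.2) := CIn.snd.comp h2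
  have ha : CIn (chi K) (fun x : (St × List Bool) × ℕ => x.1.1.2.2.1) := CIn.fst.comp h3
  have he : CIn (chi K) (fun x : (St × List Bool) × ℕ => x.1.1.2.2.2) := CIn.snd.comp h3
  have hη : CIn (chi K) (fun x : (St × List Bool) × ℕ => x.1.2) := CIn.snd.comp CIn.fst
  have hOK : CIn (chi K) (fun x : (St × List Bool) × ℕ => decide (OK L M C k0
      (x.1.1.1, x.1.1.2.1 ++ x.1.2.take x.2, 4 * x.1.1.2.2.1 + 2, x.1.1.2.2.2 + 1))) :=
    (OK_CIn hL hM h0 C k0).comp (g := fun x : (St × List Bool) × ℕ =>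
      (x.1.1.1, x.1.1.2.1 ++ x.1.2.take x.2, 4 * x.1.1.2.2.1 + 2, x.1.1.2.2.2 + 1))
      (CIn.pair hℓ (CIn.pair (hσ.append (hη.take CIn.snd))
        (CIn.pair ((CIn.mul (CIn.const 4) ha).add (CIn.const 2)) (he.add (CIn.const 1)))))
  have hr : CIn (chi K) (fun x : St × List Bool => List.range (x.2.length + 1)) :=
    CIn.map1 Primrec.list_range (CIn.snd.len.add (CIn.const 1))
  exact CIn.and hG (CIn.ball hr hOK)

theorem valid_CIn {L : Set ℕ} (hL : Low L) {M : List Bool → ℚ} (hM : FRed M K) (h0 : ∀ σ, 0 ≤ M σ)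
    (C k0 : ℕ) : CIn (chi K) (fun x : St × Yo => valid L M C k0 x.1 x.2) := by
  have hgood := good_CIn hL hM h0 C k0
  have hy : CIn (chi K) (fun x : St × Yo => x.2) := CIn.snd
  have hf : CIn (chi K) (fun x : St × Yo => x.2.1) := CIn.fst.comp hy
  have hy2 : CIn (chi K) (fun x : St × Yo => x.2.2) := CIn.snd.comp hy
  have hη : CIn (chi K) (fun x : St × Yo => x.2.2.1) := CIn.fst.comp hy2
  have h1 : CIn (chi K) (fun x : St × Yo => good L M C k0 x.1 x.2.2.1) :=
    hgood.comp (g := fun x : St × Yo => (x.1, x.2.2.1)) (CIn.pair CIn.fst hη)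
  have h2 : CIn (chi K) (fun x : (St × Yo) × List Bool => good L M C k0 x.1.1 x.2) :=
    hgood.comp (g := fun x : (St × Yo) × List Bool => (x.1.1, x.2))
      (CIn.pair (CIn.fst.comp CIn.fst) CIn.snd)
  have h3 : CIn (chi K) (fun x : St × Yo => strs x.2.2.1.length) := CIn.map1 strs_primrec hη.len
  exact (CIn.cond hf h1 (CIn.ball h3 h2.not)).and ((OK_CIn hL hM h0 C k0).comp next_CIn)

end Part8

section Part9
set_option linter.unusedSimpArgs false

theorem OK_bit {L : Set ℕ} {M : List Bool → ℚ} (hM : IsMartingale M) {C k0 : ℕ}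
    {ℓ τ a e} (h : OK L M C k0 (ℓ, τ, a, e)) : ∃ b, OK L M C k0 (ℓ, τ ++ [b], a, e) := by
  by_contra hcon
  push Not at hcon
  have key : ∀ b, ∃ k, ∀ j, (a : ℚ) * 2 ^ (k + j) <
      4 ^ e * (M (τ ++ [b]) * 2 ^ (k + j) + C * (cnt (PP L k0 ℓ) (τ ++ [b]) (k + j) : ℚ)) := by
    intro b
    have := hcon b
    simp only [OK, not_forall, not_le] at this
    obtain ⟨k, hk⟩ := this
    refine ⟨k, fun j => ?_⟩
    have h1 : (cnt (PP L k0 ℓ) (τ ++ [b]) k : ℚ) * 2 ^ j ≤ cnt (PP L k0 ℓ) (τ ++ [b]) (k + j) := by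
      exact_mod_cast (PP_mono L k0 ℓ).cnt_add (τ ++ [b]) k j
    have h2 : (0:ℚ) < 2 ^ j := by positivity
    calc (a : ℚ) * 2 ^ (k + j) = (a * 2 ^ k) * 2 ^ j := by rw [pow_add]; ring
      _ < (4 ^ e * (M (τ ++ [b]) * 2 ^ k + C * (cnt (PP L k0 ℓ) (τ ++ [b]) k : ℚ))) * 2 ^ j :=
        mul_lt_mul_of_pos_right hk h2
      _ = 4 ^ e * (M (τ ++ [b]) * 2 ^ (k + j) +
          C * ((cnt (PP L k0 ℓ) (τ ++ [b]) k : ℚ) * 2 ^ j)) := by rw [pow_add]; ring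
      _ ≤ _ := by gcongr
  obtain ⟨k, hk⟩ := key false
  obtain ⟨k', hk'⟩ := key true
  have h1 := hk k'
  have h2 := hk' k
  rw [Nat.add_comm k' k] at h2
  have h3 := h (k + k' + 1)
  simp only [cnt_succ] at h3
  have h4 := hM.2 τ
  push_cast at h3
  rw [pow_succ] at h3
  have h5 : (4:ℚ) ^ e * (M τ * (2 ^ (k + k') * 2)) =
      4 ^ e * ((M (τ ++ [false]) + M (τ ++ [true])) * 2 ^ (k + k')) := by rw [← h4]; ring
  nlinarith

theorem exists_max_bdd (v : ℕ → ℕ) (N : ℕ) (h : ∀ k, v k ≤ N) : ∃ m, ∀ k, v k ≤ v m := by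
  obtain ⟨m, hm⟩ := Nat.sInf_mem (s := Set.range (fun k => N - v k)) ⟨_, 0, rfl⟩
  refine ⟨m, fun k => ?_⟩
  have h1 : sInf (Set.range (fun k => N - v k)) ≤ N - v k := Nat.sInf_le ⟨k, rfl⟩
  simp only [] at hm
  rw [← hm] at h1
  have := h k; have := h m
  omega

theorem conv_point (V : List Bool → Bool) (σ : List Bool) (N : ℕ) :
    ∃ m, ∀ j, N * cnt V σ (m + j) ≤ N * (cnt V σ m * 2 ^ j) + 2 ^ (m + j) := by
  obtain ⟨m, hm⟩ := exists_max_bdd (fun k => N * cnt V σ k / 2 ^ k) N (fun k => by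
    apply Nat.div_le_of_le_mul
    rw [mul_comm]
    exact Nat.mul_le_mul_right _ (cnt_le _ _ _))
  refine ⟨m, fun j => ?_⟩
  have h1 := hm (m + j)
  have h2 : N * cnt V σ (m + j) < (N * cnt V σ m / 2 ^ m + 1) * 2 ^ (m + j) := by
    rw [← Nat.div_lt_iff_lt_mul (by positivity)]
    omega
  have h3 : N * cnt V σ m / 2 ^ m * 2 ^ m ≤ N * cnt V σ m := Nat.div_mul_le_self _ _
  have h4 := Nat.mul_le_mul_right (2 ^ j) h3
  rw [pow_add] at *
  nlinarith

theorem OK_new {L : Set ℕ} {M : List Bool → ℚ} {C k0 : ℕ} {ℓ σ a e}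
    (h : OK L M C k0 (ℓ, σ, a, e)) :
    ∃ m, OK L M C k0 ((e, σ.length + m) :: ℓ, σ, 4 * a + 1, e + 1) := by
  let V : List Bool → Bool := fun ρ => G e (IL L ρ)
  have hV : Mono V := fun ρ b h => G_mono h (IL_prefix _ _ _)
  obtain ⟨m, hm⟩ := conv_point V σ (C * 4 ^ (e + 1))
  refine ⟨m, fun k => ?_⟩
  have hk := h k
  simp only at hk ⊢
  have hx : (4 : ℚ) ^ (e + 1) = 4 * 4 ^ e := by rw [pow_succ]; ring
  rcases Nat.lt_or_ge k m with hkm | hkm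
  · have : cnt (PP L k0 ((e, σ.length + m) :: ℓ)) σ k ≤ cnt (PP L k0 ℓ) σ k := by
      refine cnt_mono fun η hη hP => ?_
      rw [PP_iff] at *
      rcases hP with hP | ⟨q, hq, h1, h2⟩
      · exact Or.inl hP
      · rcases List.mem_cons.1 hq with rfl | hq
        · rw [List.take_of_length_le (by simp; omega), h1] at h2
          exact absurd h2 (by simp)
        · exact Or.inr ⟨q, hq, h1, h2⟩
    have this' : (cnt (PP L k0 ((e, σ.length + m) :: ℓ)) σ k : ℚ) ≤ cnt (PP L k0 ℓ) σ k := by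
      exact_mod_cast this
    have h2 : (4:ℚ) ^ e * (M σ * 2 ^ k + C * (cnt (PP L k0 ((e, σ.length + m) :: ℓ)) σ k : ℚ)) ≤
      a * 2 ^ k := le_trans (by gcongr) hk
    have h3 : (0:ℚ) < 2 ^ k := by positivity
    rw [hx]; push_cast
    nlinarith
  · obtain ⟨j, rfl⟩ := Nat.exists_eq_add_of_le hkm
    let W : List Bool → Bool := fun ρ => V ρ && ! V (ρ.take (σ.length + m))
    have h1 : cnt (PP L k0 ((e, σ.length + m) :: ℓ)) σ (m + j) ≤
        cnt (PP L k0 ℓ) σ (m + j) + cnt W σ (m + j) := by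
      refine cnt_or fun η hη hP => ?_
      rw [PP_iff] at *
      rcases hP with hP | ⟨q, hq, h1, h2⟩
      · exact Or.inl (Or.inl hP)
      · rcases List.mem_cons.1 hq with rfl | hq
        · right; simp only at h1 h2; simp [W, V, h1, h2]
        · exact Or.inl (Or.inr ⟨q, hq, h1, h2⟩)
    have h2 : cnt V σ m * 2 ^ j + cnt W σ (m + j) ≤ cnt V σ (m + j) := by
      have e1 : cnt (fun ρ => V (ρ.take (σ.length + m))) σ (m + j) = cnt V σ m * 2 ^ j := by
        rw [cnt_split, mul_comm, cnt, ← sumN_mul]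
        refine sumN_congr fun η hη => ?_
        have : ∀ η', List.take (σ.length + m) (σ ++ η ++ η') = σ ++ η := by
          intro η'
          rw [List.take_append_of_le_length (by simp [hη])]
          exact List.take_of_length_le (by simp [hη])
        cases hv : V (σ ++ η)
        · rw [cnt_none]; · simp
          intro η' _; rw [this, hv]
        · rw [cnt_full]; · simp
          intro η' _; rw [this, hv]
      rw [← e1]
      refine cnt_and ?_ ?_ ?_
      · intro η _ h; simp only [W, h]; simp
      · intro η _ h
        have := hV.append h ((σ ++ η).drop (σ.length + m))
        rwa [List.take_append_drop] at this
      · intro η _ h; simp only [W, Bool.and_eq_true] at h; exact h.1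
    have h3 := hm j
    have h1' : (cnt (PP L k0 ((e, σ.length + m) :: ℓ)) σ (m + j) : ℚ) ≤
        cnt (PP L k0 ℓ) σ (m + j) + cnt W σ (m + j) := by exact_mod_cast h1
    have h2' : (cnt V σ m : ℚ) * 2 ^ j + cnt W σ (m + j) ≤ cnt V σ (m + j) := by exact_mod_cast h2
    have h3' : (C : ℚ) * 4 ^ (e + 1) * cnt V σ (m + j) ≤
        C * 4 ^ (e + 1) * (cnt V σ m * 2 ^ j) + 2 ^ (m + j) := by exact_mod_cast h3
    have hD : (0:ℚ) ≤ C * 4 ^ (e + 1) := by positivity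
    have h5 := mul_le_mul_of_nonneg_left h1' hD
    have h6 := mul_le_mul_of_nonneg_left h2' hD
    push_cast
    rw [hx] at *
    linarith

theorem exists_valid {L : Set ℕ} {M : List Bool → ℚ} (hM : IsMartingale M) {C k0 : ℕ} {st : St}
    (h : OK L M C k0 st) : ∃ y, valid L M C k0 st y = true := by
  obtain ⟨ℓ, σ, a, e⟩ := st
  by_cases hg : ∃ η, good L M C k0 (ℓ, σ, a, e) η = true
  · obtain ⟨η, hη⟩ := hg
    have h1 : OK L M C k0 (ℓ, σ ++ η, 4 * a + 2, e + 1) := by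
      have h2 := hη
      simp only [good, Bool.and_eq_true, List.all_eq_true, decide_eq_true_eq, List.mem_range] at h2
      simpa using h2.2 η.length (by omega)
    obtain ⟨b, hb⟩ := OK_bit hM h1
    refine ⟨(true, η, b), ?_⟩
    simp only [valid, next, hη, hb, cond_true, decide_true, Bool.and_self]
  · obtain ⟨m, hm⟩ := OK_new h
    obtain ⟨b, hb⟩ := OK_bit hM hm
    refine ⟨(false, List.replicate m false, b), ?_⟩
    push Not at hg
    simp [valid, next, hg, hb]

end Part9

section Part10
set_option linter.unusedSimpArgs false

theorem OK_weak {L : Set ℕ} {M : List Bool → ℚ} {C k0 : ℕ} {ℓ ℓ' τ a a' e e'}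
    (h : OK L M C k0 (ℓ', τ, a', e')) (hs : ∀ q ∈ ℓ, q ∈ ℓ') (he : e ≤ e')
    (ha : a' ≤ a * 4 ^ (e' - e)) : OK L M C k0 (ℓ, τ, a, e) := by
  intro k
  have hk := h k
  simp only at hk ⊢
  obtain ⟨d, rfl⟩ := Nat.exists_eq_add_of_le he
  rw [Nat.add_sub_cancel_left] at ha
  have h1 : (cnt (PP L k0 ℓ) τ k : ℚ) ≤ cnt (PP L k0 ℓ') τ k := by
    exact_mod_cast cnt_mono fun η _ hη => PP_subset hs hη
  have h2 : (a' : ℚ) ≤ a * 4 ^ d := by exact_mod_cast ha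
  have hd : (0 : ℚ) < 4 ^ d := by positivity
  refine le_of_mul_le_mul_right ?_ hd
  calc (4:ℚ) ^ e * (M τ * 2 ^ k + C * (cnt (PP L k0 ℓ) τ k : ℚ)) * 4 ^ d
      ≤ 4 ^ e * (M τ * 2 ^ k + C * (cnt (PP L k0 ℓ') τ k : ℚ)) * 4 ^ d := by gcongr
    _ = 4 ^ (e + d) * (M τ * 2 ^ k + C * (cnt (PP L k0 ℓ') τ k : ℚ)) := by rw [pow_add]; ring
    _ ≤ a' * 2 ^ k := hk
    _ ≤ (a * 4 ^ d) * 2 ^ k := by gcongr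
    _ = _ := by ring

theorem exists_limit (σ : ℕ → List Bool) (hp : ∀ n, σ n <+: σ (n + 1))
    (hl : ∀ n, n ≤ (σ n).length) : ∃ B : Set ℕ, ∀ n, seg B (σ n).length = σ n := by
  have hmono : ∀ m n, m ≤ n → σ m <+: σ n := by
    intro m n h
    induction n, h using Nat.le_induction with
    | base => exact List.prefix_rfl
    | succ n _ ih => exact ih.trans (hp n)
  refine ⟨{i | (σ (i + 1))[i]? = some true}, fun n => ?_⟩
  apply List.ext_getElem?
  intro i
  rw [seg_getElem?]
  by_cases h : i < (σ n).length
  · have hi : i < (σ (i + 1)).length := hl (i + 1)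
    have e : (σ (i + 1))[i]? = (σ n)[i]? := by
      rcases Nat.le_total (i + 1) n with h' | h'
      · obtain ⟨t, ht⟩ := hmono _ _ h'
        rw [← ht, List.getElem?_append_left hi]
      · obtain ⟨t, ht⟩ := hmono _ _ h'
        rw [← ht, List.getElem?_append_left h]
    rw [if_pos h, Set.mem_ofPred_eq, e, List.getElem?_eq_getElem h]
    cases (σ n)[i] <;> simp
  · rw [if_neg h]
    simp at h
    simp [h]

theorem IL_seg (L B : Set ℕ) (n : ℕ) : IL L (seg B n) = seg (join L B) (2 * n) := by
  rw [IL, seg_length, il_seg]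

section
variable {L : Set ℕ} {M : List Bool → ℚ} {C k0 a0 : ℕ} {F : St → Yo} {s : ℕ → St} {B : Set ℕ}

theorem seq_e (h0 : s 0 = ([], [], a0, 0)) (hs : ∀ n, s (n + 1) = next (s n) (F (s n))) (n : ℕ) :
    (s n).2.2.2 = n := by
  induction n with
  | zero => rw [h0]
  | succ n ih => rw [hs, next]; cases (F (s n)).1 <;> simp [ih]

theorem seq_a (hs : ∀ n, s (n + 1) = next (s n) (F (s n))) (e d : ℕ) :
    (s (e + d)).2.2.1 + 1 ≤ ((s e).2.2.1 + 1) * 4 ^ d := by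
  induction d with
  | zero => simp
  | succ d ih =>
    have : (s (e + (d + 1))).2.2.1 ≤ 4 * (s (e + d)).2.2.1 + 2 := by
      rw [← Nat.add_assoc, hs, next]; cases (F (s (e + d))).1 <;> simp
    rw [pow_succ, ← mul_assoc]; omega

theorem seq_l (hs : ∀ n, s (n + 1) = next (s n) (F (s n))) (e d : ℕ) :
    ∀ q ∈ (s e).1, q ∈ (s (e + d)).1 := by
  induction d with
  | zero => intro q h; exact h
  | succ d ih =>
    intro q h
    have := ih q h
    rw [← Nat.add_assoc, hs, next]; cases (F (s (e + d))).1 <;> simp [this]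

theorem seq_W (h0 : s 0 = ([], [], a0, 0)) (hs : ∀ n, s (n + 1) = next (s n) (F (s n)))
    (hok : ∀ n, OK L M C k0 (s n)) (hv : ∀ n, valid L M C k0 (s n) (F (s n)) = true)
    (hB : ∀ n, seg B (s n).2.1.length = (s n).2.1) (hl : ∀ n, n ≤ (s n).2.1.length)
    (e n : ℕ) (hn : (s e).2.1.length ≤ n) :
    OK L M C k0 ((s e).1, seg B n, (s e).2.2.1 + 1, e) := by
  -- find j ≥ e with |σ_j| ≤ n ≤ |σ_{j+1}|
  obtain ⟨d, hd1, hd2⟩ : ∃ d, (s (e + d)).2.1.length ≤ n ∧ n ≤ (s (e + d + 1)).2.1.length := by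
    by_contra hcon
    push Not at hcon
    have : ∀ d, (s (e + d)).2.1.length ≤ n := by
      intro d
      induction d with
      | zero => exact hn
      | succ d ih => exact (hcon d ih).le
    have h1 := this (n + 1)
    have h2 := hl (e + (n + 1))
    omega
  have hstep : OK L M C k0 ((s (e + d)).1, seg B n, 4 * (s (e + d)).2.2.1 + 2, e + d + 1) := by
    have he := seq_e h0 hs (e + d)
    generalize e + d = j at *
    have hvj := hv j
    have hsj := hs j
    rcases hy : F (s j) with ⟨fl, η, b⟩
    rw [hy] at hvj hsj
    rw [valid, ← hsj, Bool.and_eq_true, decide_eq_true_eq] at hvj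
    obtain ⟨hv1, hv2⟩ := hvj
    have hend : n = (s (j + 1)).2.1.length →
        OK L M C k0 ((s j).1, seg B n, 4 * (s j).2.2.1 + 2, j + 1) := by
      rintro rfl
      rw [hB]
      have e1 := seq_e h0 hs (j + 1)
      have hv2' : OK L M C k0 ((s (j+1)).1, (s (j+1)).2.1, (s (j+1)).2.2.1, j + 1) := by
        have h3 : OK L M C k0 ((s (j+1)).1, (s (j+1)).2.1, (s (j+1)).2.2.1, (s (j+1)).2.2.2) := hv2
        rwa [e1] at h3
      refine OK_weak hv2' (seq_l hs j 1) le_rfl ?_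
      have : (s (j + 1)).2.2.1 ≤ 4 * (s j).2.2.1 + 2 := by
        rw [hsj, next]; cases fl <;> simp
      simpa using this
    cases fl with
    | true =>
      simp only [next, cond_true] at hsj hv1
      by_cases hlast : n = (s (j + 1)).2.1.length
      · exact hend hlast
      · have hlen : (s (j + 1)).2.1.length = (s j).2.1.length + η.length + 1 := by
          rw [hsj]; simp; omega
        have hseg : seg B n = (s j).2.1 ++ η.take (n - (s j).2.1.length) := by
          rw [← seg_take B hd2, hB, hsj]
          simp only
          rw [List.take_append_of_le_length (by simp; omega), List.take_append,
            List.take_of_length_le hd1]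
        simp only [good, Bool.and_eq_true, List.all_eq_true, decide_eq_true_eq,
          List.mem_range] at hv1
        have := hv1.2 (n - (s j).2.1.length) (by omega)
        rw [hseg]
        rw [he] at this
        exact this
    | false =>
      simp only [next, cond_false] at hsj
      have hlen : (s (j + 1)).2.1.length = (s j).2.1.length + 1 := by
        rw [hsj]; simp
      by_cases hlast : n = (s (j + 1)).2.1.length
      · exact hend hlast
      · have : n = (s j).2.1.length := by omega
        subst this
        rw [hB]
        intro k
        have h1 := hok j k
        rw [he] at h1
        simp only
        rw [pow_succ]
        push_cast
        have : (0:ℚ) < 2 ^ k := by positivity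
        nlinarith
  refine OK_weak hstep (seq_l hs e d) (by omega) ?_
  have h1 := seq_a hs e d
  have h2 : e + d + 1 - e = d + 1 := by omega
  rw [h2, pow_succ, ← mul_assoc]
  omega

theorem seq_noP (hM0 : ∀ σ, 0 ≤ M σ) (h0 : s 0 = ([], [], a0, 0))
    (hs : ∀ n, s (n + 1) = next (s n) (F (s n)))
    (hok : ∀ n, OK L M C k0 (s n)) (hv : ∀ n, valid L M C k0 (s n) (F (s n)) = true)
    (hB : ∀ n, seg B (s n).2.1.length = (s n).2.1) (hl : ∀ n, n ≤ (s n).2.1.length)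
    (hC : C = a0 + 2)
    (e n : ℕ) (hn : (s e).2.1.length ≤ n) : PP L k0 (s e).1 (seg B n) = false := by
  by_contra hP
  have hW := seq_W h0 hs hok hv hB hl e n hn 0
  have hP : PP L k0 (s e).1 (seg B n) = true := by simpa using hP
  simp only [cnt, sumN, hP, pow_zero, mul_one, Bool.toNat_true, Nat.cast_one] at hW
  have ha := seq_a hs 0 e
  rw [h0, Nat.zero_add] at ha
  have ha' : ((s e).2.2.1 : ℚ) + 1 ≤ (a0 + 1) * 4 ^ e := by exact_mod_cast ha
  have hp : (0:ℚ) < 4 ^ e := by positivity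
  have hm := mul_nonneg hp.le (hM0 (seg B n))
  push_cast at hW
  subst hC
  push_cast at hW
  nlinarith

theorem seq_jump (hM0 : ∀ σ, 0 ≤ M σ) (h0 : s 0 = ([], [], a0, 0))
    (hs : ∀ n, s (n + 1) = next (s n) (F (s n)))
    (hok : ∀ n, OK L M C k0 (s n)) (hv : ∀ n, valid L M C k0 (s n) (F (s n)) = true)
    (hB : ∀ n, seg B (s n).2.1.length = (s n).2.1) (hl : ∀ n, n ≤ (s n).2.1.length)
    (hC : C = a0 + 2) (e : ℕ) : e ∈ jump (join L B) ↔ (F (s e)).1 = true := by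
  have he := seq_e h0 hs e
  have hve := hv e
  have hse := hs e
  rw [mem_jump_iff]
  rcases hy : F (s e) with ⟨fl, η, b⟩
  rw [hy] at hve hse
  rw [valid, ← hse, Bool.and_eq_true] at hve
  have hv1 := hve.1
  cases fl with
  | true =>
    simp only [iff_true]
    simp only [next, cond_true] at hse hv1
    simp only [good, Bool.and_eq_true, he] at hv1
    have hseg : seg B ((s e).2.1.length + η.length) = (s e).2.1 ++ η := by
      have hle : (s e).2.1.length + η.length ≤ (s (e + 1)).2.1.length := by
        rw [hse]; simp
      rw [← seg_take B hle, hB, hse]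
      simp only
      rw [← List.length_append]
      exact List.take_left
    refine ⟨2 * ((s e).2.1.length + η.length), ?_⟩
    rw [← IL_seg, hseg]
    exact hv1.1
  | false =>
    simp only [Bool.false_eq_true, iff_false]
    rintro ⟨n', hn'⟩
    simp only [next, cond_false] at hse hv1
    set t := (s e).2.1.length + η.length with ht
    have hlen : (s (e + 1)).2.1.length = (s e).2.1.length + 1 := by rw [hse]; simp
    let n := max n' (t + 1)
    have hGn : G e (IL L (seg B n)) = true := by
      rw [IL_seg]
      exact G_mono hn' (seg_prefix _ (by simp only [n]; omega))
    have hno := seq_noP hM0 h0 hs hok hv hB hl hC (e + 1) n (by simp only [n]; omega)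
    cases hGt : G e (IL L (seg B t)) with
    | false =>
      have : PP L k0 (s (e + 1)).1 (seg B n) = true := by
        rw [PP_iff]
        right
        refine ⟨(e, t), ?_, hGn, ?_⟩
        · rw [hse, he]; simp
        · rw [seg_take B (by simp only [n]; omega)]; exact hGt
      rw [hno] at this
      exact absurd this (by simp)
    | true =>
      have hsplit : seg B t = (s e).2.1 ++ (seg B t).drop (s e).2.1.length := by
        conv_lhs => rw [← List.take_append_drop (s e).2.1.length (seg B t)]
        rw [seg_take B (by omega), hB]
      set η' := (seg B t).drop (s e).2.1.length with hη'
      have hl' : η'.length = η.length := by simp [hη', ht]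
      rw [List.all_eq_true] at hv1
      have hng := hv1 η' (mem_strs.2 hl')
      have hgood : good L M C k0 (s e) η' = true := by
        simp only [good, Bool.and_eq_true, List.all_eq_true, decide_eq_true_eq, List.mem_range]
        refine ⟨by rw [← hsplit, he]; exact hGt, fun j hj => ?_⟩
        have hsegj : (s e).2.1 ++ η'.take j = seg B ((s e).2.1.length + j) := by
          have h5 : ((s e).2.1 ++ η').take ((s e).2.1.length + j) = (s e).2.1 ++ η'.take j := by
            rw [List.take_append, List.take_of_length_le (l := (s e).2.1) (by omega)]
            simp
          rw [← h5, ← hsplit]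
          exact seg_take B (by omega)
        rcases Nat.eq_zero_or_pos j with rfl | hj0
        · simp only [List.take_zero, List.append_nil]
          have h1 : OK L M C k0 ((s e).1, (s e).2.1, (s e).2.2.1, (s e).2.2.2) := hok e
          intro k
          have h1 := h1 k
          simp only at h1 ⊢
          rw [pow_succ]
          push_cast
          have : (0:ℚ) < 2 ^ k := by positivity
          nlinarith
        · rw [hsegj, he]
          have hW := seq_W h0 hs hok hv hB hl (e + 1) ((s e).2.1.length + j) (by omega)
          refine OK_weak hW (seq_l hs e 1) le_rfl ?_
          rw [hse]; simp
      rw [hgood] at hng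
      exact absurd hng (by simp)
end

theorem main_thm (L : Set ℕ) (hlow : Low L) (hrand : MLRandom L) (M : List Bool → ℚ)
    (hM : IsMartingale M) (hMK : FRed M K) :
    ∃ B : Set ℕ, ¬ Succeeds M B ∧ Low (join L B) ∧ MLRandom (join L B) := by
  obtain ⟨m, hm⟩ := exists_nat_ge (M [])
  let a0 := m + 1
  let C := a0 + 2
  obtain ⟨k0, hk0⟩ := lemmaR hrand C
  have hinit : OK L M C k0 ([], [], a0, 0) := by
    intro k
    have h1 : cnt (PP L k0 []) [] k ≤ cnt (fun ρ => UU k0 (il (seg L k) ρ)) [] k := by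
      refine cnt_mono fun η hη h => ?_
      rw [PP_iff] at h
      rcases h with h | ⟨q, hq, _⟩
      · simpa [IL, hη] using h
      · simp at hq
    have h2 : C * cnt (PP L k0 []) [] k ≤ 2 ^ k :=
      le_trans (Nat.mul_le_mul (Nat.lt_two_pow_self).le h1) (hk0 k)
    have h2' : (C : ℚ) * cnt (PP L k0 []) [] k ≤ 2 ^ k := by exact_mod_cast h2
    have h3 : M [] * 2 ^ k ≤ m * 2 ^ k := by gcongr
    simp only [a0]
    push_cast
    rw [pow_zero, one_mul]
    linarith
  have hp : CIn (chi K) (fun x : St × Yo => ! decide (OK L M C k0 x.1) || valid L M C k0 x.1 x.2) :=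
    CIn.or ((OK_CIn hlow hMK hM.1 C k0).comp CIn.fst).not (valid_CIn hlow hMK hM.1 C k0)
  obtain ⟨F, hF, hFv⟩ := CIn.search hp (fun st => by
    by_cases h : OK L M C k0 st
    · obtain ⟨y, hy⟩ := exists_valid hM h
      exact ⟨y, by simp [hy]⟩
    · exact ⟨(true, [], true), by simp [h]⟩)
  let s : ℕ → St := fun n => Nat.rec ([], [], a0, 0) (fun _ st => next st (F st)) n
  have hsC : CIn (chi K) s := by
    have hg : CIn (chi K) (fun x : Unit × ℕ × St => next x.2.2 (F x.2.2)) :=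
      next_CIn.comp (g := fun x : Unit × ℕ × St => (x.2.2, F x.2.2))
        (CIn.pair (CIn.snd.comp CIn.snd) (hF.comp (CIn.snd.comp CIn.snd)))
    exact (CIn.nat_rec (CIn.const (([], [], a0, 0) : St)) hg).comp
      (CIn.pair (CIn.const ()) CIn.id)
  have h0 : s 0 = ([], [], a0, 0) := rfl
  have hs : ∀ n, s (n + 1) = next (s n) (F (s n)) := fun n => rfl
  have hok : ∀ n, OK L M C k0 (s n) := by
    intro n
    induction n with
    | zero => exact hinit
    | succ n ih =>
      have := hFv (s n)
      simp only [ih, decide_true, Bool.not_true, Bool.false_or, valid, Bool.and_eq_true,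
        decide_eq_true_eq] at this
      exact this.2
  have hv : ∀ n, valid L M C k0 (s n) (F (s n)) = true := by
    intro n
    have := hFv (s n)
    simpa only [hok n, decide_true, Bool.not_true, Bool.false_or] using this
  have hpre : ∀ n, (s n).2.1 <+: (s (n + 1)).2.1 ∧
      (s n).2.1.length + 1 ≤ (s (n + 1)).2.1.length := by
    intro n
    rw [hs, next]
    cases (F (s n)).1
    · simp
    · simp
  have hl : ∀ n, n ≤ (s n).2.1.length := by
    intro n
    induction n with
    | zero => simp
    | succ n ih => have := (hpre n).2; omega
  obtain ⟨B, hB⟩ := exists_limit (fun n => (s n).2.1) (fun n => (hpre n).1) hl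
  refine ⟨B, ?_, ?_, ?_⟩
  · intro hsucc
    obtain ⟨n, hn⟩ := hsucc (a0 + 1)
    have hW := seq_W h0 hs hok hv hB hl 0 n (by simp [h0]) 0
    simp only [h0, pow_zero, one_mul, mul_one] at hW
    push_cast at hW
    have : (0:ℚ) ≤ C * (cnt (PP L k0 []) (seg B n) 0 : ℚ) := by positivity
    linarith
  · have hj := seq_jump hM.1 h0 hs hok hv hB hl rfl
    have h1 : CIn (chi K) (fun e => (bif (F (s e)).1 then 1 else 0 : ℕ)) :=
      CIn.cond (CIn.fst.comp (hF.comp hsC)) (CIn.const 1) (CIn.const 0)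
    refine (CIn.to_TR h1).of_eq fun e => ?_
    have := hj e
    rw [chi]
    by_cases h : e ∈ jump (join L B)
    · rw [if_pos h, this.1 h]; rfl
    · rw [if_neg h]
      have h2 : (F (s e)).1 = false := by simpa using fun h' => h (this.2 h')
      rw [h2]; rfl
  · refine random_of_UU (k := k0) fun n => ?_
    by_contra hU
    have hU : UU k0 (seg (join L B) n) = true := by simpa using hU
    have h1 := seq_noP hM.1 h0 hs hok hv hB hl rfl 0 n (by simp [h0])
    have h2 : PP L k0 (s 0).1 (seg B n) = true := by
      rw [PP_iff]
      left
      rw [IL_seg]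
      obtain ⟨t, ht⟩ := seg_prefix (join L B) (show n ≤ 2 * n by omega)
      rw [← ht]
      exact (UU_mono k0).append hU t
    rw [h1] at h2
    exact absurd h2 (by simp)

end Part10

/-- if `L` is low and 1-random and `M` is a `∅'`-computable martingale,
then there is `B` with `M` not succeeding on `B` and `L ⊕ B` low and 1-random. -/
theorem stmt14 (L : Set ℕ) (hlow : Low L) (hrand : MLRandom L)
    (M : List Bool → ℚ) (hM : IsMartingale M) (hMK : FRed M K) :
    ∃ B : Set ℕ, ¬ Succeeds M B ∧ Low (join L B) ∧ MLRandom (join L B) :=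
  main_thm L hlow hrand M hM hMK
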